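/- Assume the Riemann hypothesis. For Δ > 0 let c_Δ^± = (e^{πΔ/2} ∓ e^{−πΔ/2})² and B = (log 4π)/2 − 1 − γ/2. Then for every real t > 0 and every Δ ≥ 1/2 one has, for each fixed choice of sign taken consistently, ± Re(ζ'/ζ(1 + it)) ≤ (log t − log 2π)/(e^{πΔ} ∓ 1) + (e^{2πΔ}/(e^{πΔ} ∓ 1)²) · ( 2πΔ − (1 + γ) + (log 2π)/e^{2πΔ} + 2|B|/e^{πΔ} ) + ( 6.5/t² − 1/(6 c_Δ^± e^{5πΔ}) ). -/

import Mathlib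

open Complex

/-- The constant `B = (log 4π)/2 − 1 − γ/2 = −0.02309…`. -/
noncomputable def Bconst : ℝ :=
  Real.log (4 * Real.pi) / 2 - 1 - Real.eulerMascheroniConstant / 2


namespace PMZ
open Filter Topology Set

/-- Weierstrass terms. -/
noncomputable def gk (k : ℕ) (z : ℂ) : ℂ := z / (k + 1) - log (1 + z / (k + 1))

noncomputable def gkd (k : ℕ) (z : ℂ) : ℂ := 1 / (k + 1) - 1 / (k + 1 + z)

def Dom (R : ℝ) : Set ℂ := {z | -1 / 2 < z.re} ∩ Metric.ball 0 R

lemma k1_ne (k : ℕ) : ((k : ℂ) + 1) ≠ 0 := by exact_mod_cast Nat.succ_ne_zero k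

lemma one_add_mem (k : ℕ) {z : ℂ} (hz : -1 / 2 < z.re) : 0 < (1 + z / (k + 1)).re := by
  have h1 : (0 : ℝ) < k + 1 := by positivity
  have : (z / ((k : ℂ) + 1)).re = z.re / (k + 1) := by
    have : ((k : ℂ) + 1) = ((k + 1 : ℝ) : ℂ) := by push_cast; rfl
    rw [this, div_ofReal_re]
  rw [add_re, this, one_re]
  have hk : (0 : ℝ) ≤ k := by positivity
  rw [← sub_lt_iff_lt_add', lt_div_iff₀ h1]
  nlinarith

lemma norm_kz (k : ℕ) {z : ℂ} (hz : -1 / 2 < z.re) : ((k : ℝ) + 1) / 2 ≤ ‖(k : ℂ) + 1 + z‖ := by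
  refine le_trans ?_ (re_le_norm _)
  simp
  have hk : (0 : ℝ) ≤ k := by positivity
  linarith

lemma kz_ne (k : ℕ) {z : ℂ} (hz : -1 / 2 < z.re) : (k : ℂ) + 1 + z ≠ 0 := by
  have := norm_kz k hz
  rw [← norm_pos_iff]
  have hk : (0 : ℝ) ≤ k := by positivity
  linarith

lemma gk_hasDerivAt (k : ℕ) {z : ℂ} (hz : -1 / 2 < z.re) : HasDerivAt (gk k) (gkd k z) z := by
  have h := one_add_mem k hz
  have hd : HasDerivAt (fun z : ℂ => z / ((k : ℂ) + 1)) (1 / (k + 1)) z :=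
    (hasDerivAt_id z).div_const _
  have h2 := (hd.const_add 1).clog (Or.inl h)
  convert! hd.sub h2 using 1
  unfold gkd
  congr 1
  have := k1_ne k
  have := kz_ne k hz
  field_simp

lemma gkd_eq (k : ℕ) {z : ℂ} (hz : -1 / 2 < z.re) :
    gkd k z = z / (((k : ℂ) + 1) * (k + 1 + z)) := by
  have := k1_ne k
  have := kz_ne k hz
  unfold gkd; field_simp; ring

lemma norm_k1 (k : ℕ) : ‖(k : ℂ) + 1‖ = (k : ℝ) + 1 := by
  have : ((k : ℂ) + 1) = ((k + 1 : ℝ) : ℂ) := by push_cast; rfl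
  rw [this, norm_real, Real.norm_of_nonneg (by positivity)]

lemma gkd_bound (R : ℝ) (k : ℕ) {z : ℂ} (hz : z ∈ Dom R) :
    ‖gkd k z‖ ≤ 2 * R * (1 / ((k : ℝ) + 1) ^ 2) := by
  have hz1 : -1 / 2 < z.re := hz.1
  have hz2 : ‖z‖ < R := by simpa using hz.2
  rw [gkd_eq k hz1, norm_div, norm_mul, norm_k1]
  have h1 : (0 : ℝ) < k + 1 := by positivity
  have h3' : 0 < ‖(k : ℂ) + 1 + z‖ := lt_of_lt_of_le (by positivity) (norm_kz k hz1)
  rw [div_le_iff₀ (by positivity)]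
  have h3 := norm_kz k hz1
  calc ‖z‖ ≤ R := hz2.le
    _ = 2 * R * (1 / ((k : ℝ) + 1) ^ 2) * ((k + 1) * ((k + 1) / 2)) := by field_simp
    _ ≤ _ := by
      have : 0 < R := lt_of_le_of_lt (norm_nonneg _) hz2
      gcongr

lemma summ_sq : Summable (fun k : ℕ => 1 / ((k : ℝ) + 1) ^ 2) := by
  have := (summable_nat_add_iff 1).2 (Real.summable_one_div_nat_pow.2 (one_lt_two))
  simpa using this

lemma Dom_open (R : ℝ) : IsOpen (Dom R) :=
  (isOpen_lt continuous_const continuous_re).inter Metric.isOpen_ball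

lemma Dom_conn (R : ℝ) : IsPreconnected (Dom R) :=
  ((convex_halfSpace_re_gt (-1 / 2)).inter (convex_ball 0 R)).isPreconnected

lemma mem_Dom {z : ℂ} (hz : -1 / 2 < z.re) : z ∈ Dom (‖z‖ + 1) := ⟨hz, by simp⟩

lemma zero_mem_Dom (z : ℂ) : (0 : ℂ) ∈ Dom (‖z‖ + 1) := ⟨by norm_num, by simp; positivity⟩

lemma gk_zero (k : ℕ) : gk k 0 = 0 := by simp [gk]

lemma gk_summable {z : ℂ} (hz : -1 / 2 < z.re) : Summable (fun k => gk k z) :=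
  summable_of_summable_hasDerivAt_of_isPreconnected (summ_sq.mul_left _) (Dom_open (‖z‖ + 1))
    (Dom_conn _) (fun k y hy => gk_hasDerivAt k hy.1) (fun k y hy => gkd_bound _ k hy)
    (zero_mem_Dom z) (by simp [gk_zero, summable_zero]) (mem_Dom hz)

lemma gkd_summable {z : ℂ} (hz : -1 / 2 < z.re) : Summable (fun k => gkd k z) :=
  Summable.of_norm_bounded (summ_sq.mul_left _) (fun k => gkd_bound _ k (mem_Dom hz))

lemma gk_tsum_hasDerivAt {z : ℂ} (hz : -1 / 2 < z.re) :
    HasDerivAt (fun z => ∑' k, gk k z) (∑' k, gkd k z) z :=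
  hasDerivAt_tsum_of_isPreconnected (summ_sq.mul_left _) (Dom_open (‖z‖ + 1))
    (Dom_conn _) (fun k y hy => gk_hasDerivAt k hy.1) (fun k y hy => gkd_bound _ k hy)
    (zero_mem_Dom z) (by simp [gk_zero, summable_zero]) (mem_Dom hz)

lemma GammaSeq_eq {z : ℂ} (hz : -1 / 2 < z.re) (hz0 : z ≠ 0) {n : ℕ} (hn : n ≠ 0) :
    z * GammaSeq z n = exp (-z * ((harmonic n : ℝ) - Real.log n : ℝ)) *
      exp (∑ k ∈ Finset.range n, gk k z) := by
  have hprod : exp (∑ k ∈ Finset.range n, gk k z) =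
      exp (z * (harmonic n : ℝ)) * ∏ k ∈ Finset.range n, (((k : ℂ) + 1) / (z + (k + 1))) := by
    rw [Complex.exp_sum]
    have : z * ((harmonic n : ℝ) : ℂ) = ∑ k ∈ Finset.range n, z / ((k : ℂ) + 1) := by
      simp [harmonic, Finset.mul_sum, div_eq_mul_inv]
    rw [this, Complex.exp_sum, ← Finset.prod_mul_distrib]
    refine Finset.prod_congr rfl fun k _ => ?_
    unfold gk
    rw [Complex.exp_sub, exp_log]
    · have := k1_ne k
      have := kz_ne k hz
      have h3 : z + ((k : ℂ) + 1) ≠ 0 := by rwa [add_comm]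
      have h4 : (1 + z / ((k : ℂ) + 1)) = (z + (k + 1)) / (k + 1) := by field_simp; ring
      rw [h4]
      field_simp
    · intro h0
      have := one_add_mem k hz
      rw [h0] at this; simp at this
  rw [hprod, GammaSeq, Finset.prod_range_succ', Finset.prod_div_distrib]
  have hfac : ((n.factorial : ℕ) : ℂ) = ∏ k ∈ Finset.range n, ((k : ℂ) + 1) := by
    rw [← Finset.prod_range_add_one_eq_factorial]; push_cast; rfl
  rw [hfac, cpow_def_of_ne_zero (by exact_mod_cast hn)]
  have hpne : ∏ k ∈ Finset.range n, (z + ((k : ℂ) + 1)) ≠ 0 := by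
    rw [Finset.prod_ne_zero_iff]
    intro k _
    have := kz_ne k hz
    rwa [add_comm]
  push_cast
  have he : exp (log (n : ℂ) * z) =
      exp (-z * ((harmonic n : ℂ) - log (n : ℂ))) * exp (z * (harmonic n : ℂ)) := by
    rw [← Complex.exp_add]; congr 1; ring
  rw [he, add_zero, mul_div_assoc']
  rw [mul_comm _ z, mul_div_mul_left _ _ hz0]
  ring

theorem Gamma_add_one_eq {z : ℂ} (hz : -1 / 2 < z.re) :
    Gamma (z + 1) = exp (-z * Real.eulerMascheroniConstant + ∑' k, gk k z) := by
  rcases eq_or_ne z 0 with rfl | hz0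
  · simp [gk_zero]
  rw [Gamma_add_one _ hz0, Complex.exp_add]
  refine tendsto_nhds_unique ((GammaSeq_tendsto_Gamma z).const_mul z) ?_
  have h1 : Tendsto (fun n : ℕ => exp (-z * ((harmonic n : ℝ) - Real.log n : ℝ)) *
      exp (∑ k ∈ Finset.range n, gk k z)) atTop
      (𝓝 (exp (-z * Real.eulerMascheroniConstant) * exp (∑' k, gk k z))) := by
    refine Tendsto.mul ?_ ?_
    · refine (continuous_exp.tendsto _).comp (Tendsto.const_mul _ ?_)
      exact (continuous_ofReal.tendsto _).comp Real.tendsto_harmonic_sub_log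
    · exact (continuous_exp.tendsto _).comp (gk_summable hz).hasSum.tendsto_sum_nat
  refine h1.congr' ?_
  filter_upwards [eventually_ne_atTop 0] with n hn
  exact (GammaSeq_eq hz hz0 hn).symm

theorem Gamma_add_one_hasDerivAt {z : ℂ} (hz : -1 / 2 < z.re) :
    HasDerivAt (fun z => Gamma (z + 1))
      (Gamma (z + 1) * (-Real.eulerMascheroniConstant + ∑' k, gkd k z)) z := by
  have h : HasDerivAt (fun z : ℂ => exp (-z * Real.eulerMascheroniConstant + ∑' k, gk k z))
      (exp (-z * Real.eulerMascheroniConstant + ∑' k, gk k z) *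
        (-Real.eulerMascheroniConstant + ∑' k, gkd k z)) z := by
    refine HasDerivAt.cexp ?_
    refine HasDerivAt.add ?_ (gk_tsum_hasDerivAt hz)
    simpa using ((hasDerivAt_id z).neg.mul_const (Real.eulerMascheroniConstant : ℂ))
  rw [Gamma_add_one_eq hz]
  refine h.congr_of_eventuallyEq ?_
  filter_upwards [(isOpen_lt continuous_const continuous_re).mem_nhds hz] with w hw
  exact Gamma_add_one_eq hw


/-- `Psi s` is the logarithmic derivative of `π^{-s/2} Γ(s/2+1)`. -/
noncomputable def Psi (s : ℂ) : ℂ :=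
  -Real.eulerMascheroniConstant / 2 - Real.log Real.pi / 2
    + ∑' k : ℕ, (1 / (2 * ((k : ℂ) + 1)) - 1 / (s + 2 * (k + 1)))

noncomputable def Gfun (s : ℂ) : ℂ := (Real.pi : ℂ) ^ (-s / 2) * Gamma (s / 2 + 1)

lemma half_re {s : ℂ} (hs : -1 < s.re) : -1 / 2 < (s / 2).re := by
  have : (s / 2).re = s.re / 2 := by
    have := div_ofReal_re s 2
    simpa using this
  rw [this]; linarith

lemma Psi_term {s : ℂ} (hs : -1 < s.re) (k : ℕ) :
    (1 / (2 * ((k : ℂ) + 1)) - 1 / (s + 2 * (k + 1))) = gkd k (s / 2) / 2 := by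
  have h1 := k1_ne k
  have h2 := kz_ne k (half_re hs)
  have h3 : s + 2 * ((k : ℂ) + 1) ≠ 0 := by
    intro h
    apply h2
    linear_combination h / 2
  have h4 : (k : ℂ) + 1 + s / 2 = (s + 2 * (k + 1)) / 2 := by ring
  unfold gkd
  rw [h4]
  field_simp

lemma Psi_summable {s : ℂ} (hs : -1 < s.re) :
    Summable (fun k : ℕ => (1 / (2 * ((k : ℂ) + 1)) - 1 / (s + 2 * (k + 1)))) := by
  simp_rw [Psi_term hs]
  exact (gkd_summable (half_re hs)).div_const 2

lemma Psi_eq {s : ℂ} (hs : -1 < s.re) :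
    Psi s = (-Real.eulerMascheroniConstant + ∑' k, gkd k (s / 2)) / 2 - Real.log Real.pi / 2 := by
  unfold Psi
  simp_rw [Psi_term hs]
  rw [tsum_div_const]; ring

lemma Gfun_ne_zero {s : ℂ} (hs : -1 < s.re) : Gfun s ≠ 0 := by
  unfold Gfun
  refine mul_ne_zero ?_ ?_
  · simp [cpow_eq_zero_iff, Real.pi_ne_zero]
  · refine Gamma_ne_zero_of_re_pos ?_
    have := half_re hs
    rw [add_re, one_re]; linarith

lemma Gfun_hasDerivAt {s : ℂ} (hs : -1 < s.re) : HasDerivAt Gfun (Gfun s * Psi s) s := by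
  have h1 : HasDerivAt (fun s : ℂ => s / 2) (1 / 2) s := (hasDerivAt_id s).div_const 2
  have h2 := (Gamma_add_one_hasDerivAt (half_re hs)).comp s h1
  have h3 : HasDerivAt (fun s : ℂ => (Real.pi : ℂ) ^ (-s / 2))
      ((Real.pi : ℂ) ^ (-s / 2) * Complex.log Real.pi * (-1 / 2)) s := by
    refine HasDerivAt.const_cpow ((hasDerivAt_id s).neg.div_const 2) (Or.inl ?_)
    exact_mod_cast Real.pi_ne_zero
  convert! h3.mul h2 using 1
  rw [Psi_eq hs, ← ofReal_log Real.pi_pos.le]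
  simp only [Gfun, Function.comp]
  ring

lemma Psi_eq_logDeriv {s : ℂ} (hs : -1 < s.re) : Psi s = logDeriv Gfun s := by
  rw [logDeriv_apply, (Gfun_hasDerivAt hs).deriv]
  field_simp [Gfun_ne_zero hs]

lemma Psi_continuousAt {s : ℂ} (hs : -1 < s.re) : ContinuousAt Psi s := by
  have hopen : IsOpen {s : ℂ | -1 < s.re} := isOpen_lt continuous_const continuous_re
  have hd : DifferentiableOn ℂ Gfun {s : ℂ | -1 < s.re} := fun w hw =>
    (Gfun_hasDerivAt hw).differentiableAt.differentiableWithinAt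
  have hc : ContinuousAt (fun w => deriv Gfun w / Gfun w) s :=
    ((hd.deriv hopen).continuousOn.continuousAt (hopen.mem_nhds hs)).div
      (Gfun_hasDerivAt hs).continuousAt (Gfun_ne_zero hs)
  refine hc.congr ?_
  filter_upwards [hopen.mem_nhds hs] with w hw
  rw [Psi_eq_logDeriv hw, logDeriv_apply]

lemma Psi_zero : Psi 0 = -Real.eulerMascheroniConstant / 2 - Real.log Real.pi / 2 := by
  unfold Psi; simp

lemma Psi_one : Psi 1 = -Real.eulerMascheroniConstant / 2 - Real.log Real.pi / 2
    + 1 - Real.log 2 := by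
  have h1 : Psi 1 = logDeriv Gfun 1 := Psi_eq_logDeriv (by norm_num)
  have h2 := digamma_apply_add_one (1 / 2) (fun m h => by
    have := congrArg re h
    simp at this
    have hm : (0 : ℝ) ≤ m := by positivity
    linarith)
  rw [digamma_one_half] at h2
  have h3 := Gamma_add_one_hasDerivAt (z := 1 / 2) (by norm_num)
  have h4 : digamma (1 / 2 + 1) = -Real.eulerMascheroniConstant + ∑' k, gkd k (1 / 2) := by
    rw [digamma_def, logDeriv_apply]
    have h5 : HasDerivAt (fun z : ℂ => Gamma (z + 1)) (deriv Gamma (1 / 2 + 1)) (1 / 2) := by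
      have := (differentiableAt_Gamma (1 / 2 + 1 : ℂ) ?_).hasDerivAt.comp_add_const (1 / 2) 1
      · exact this
      · intro m h
        have := congrArg re h
        simp at this
        have hm : (0 : ℝ) ≤ m := by positivity
        linarith
    have h6 := h5.unique h3
    have h7 : Gamma (1 / 2 + 1) ≠ 0 := Gamma_ne_zero_of_re_pos (by norm_num)
    rw [h6, mul_div_cancel_left₀ _ h7]
  rw [Psi_eq (by norm_num), ← h4, h2]
  have : (Real.log 2 : ℂ) = log 2 := by
    have := ofReal_log (show (0 : ℝ) ≤ 2 by norm_num)
    simpa using this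
  rw [this]
  field_simp
  ring

/-- Growth bound for a single term. -/
lemma Psi_term_bound {s : ℂ} (hs : 0 ≤ s.re) (k : ℕ) :
    ‖(1 / (2 * ((k : ℂ) + 1)) - 1 / (s + 2 * (k + 1)))‖ ≤
      Real.sqrt (1 + ‖s‖) * (1 / ((k : ℝ) + 1) ^ (3 / 2 : ℝ)) := by
  have h1 : (0 : ℝ) < k + 1 := by positivity
  have hk := k1_ne k
  have hre : (s + 2 * ((k : ℂ) + 1)).re = s.re + 2 * (k + 1) := by simp
  have him : (s + 2 * ((k : ℂ) + 1)).im = s.im := by simp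
  have hn : ‖s‖ ^ 2 + 4 * (k + 1) ^ 2 ≤ ‖s + 2 * ((k : ℂ) + 1)‖ ^ 2 := by
    rw [← normSq_eq_norm_sq, ← normSq_eq_norm_sq, normSq_apply, normSq_apply, hre, him]
    nlinarith [mul_nonneg hs h1.le]
  have hpos : 0 < ‖s + 2 * ((k : ℂ) + 1)‖ := by
    by_contra h
    have : ‖s + 2 * ((k : ℂ) + 1)‖ = 0 := le_antisymm (not_lt.1 h) (norm_nonneg _)
    rw [this] at hn
    nlinarith [sq_nonneg ‖s‖]
  have hne : s + 2 * ((k : ℂ) + 1) ≠ 0 := norm_pos_iff.1 hpos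
  have e : (1 / (2 * ((k : ℂ) + 1)) - 1 / (s + 2 * (k + 1))) =
      s / (2 * ((k : ℂ) + 1) * (s + 2 * (k + 1))) := by field_simp; ring
  rw [e, norm_div, norm_mul, norm_mul, norm_k1, norm_ofNat]
  have hpow : ((k : ℝ) + 1) ^ (3 / 2 : ℝ) = (k + 1) * Real.sqrt (k + 1) := by
    rw [Real.sqrt_eq_rpow, show (3 / 2 : ℝ) = 1 + 1 / 2 by norm_num, Real.rpow_add h1,
      Real.rpow_one]
  rw [hpow, mul_one_div, div_le_div_iff₀ (by positivity) (by positivity)]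
  have key : ‖s‖ * Real.sqrt (k + 1) ≤ Real.sqrt (1 + ‖s‖) * (2 * ‖s + 2 * ((k : ℂ) + 1)‖) := by
    apply le_of_sq_le_sq _ (by positivity)
    rw [mul_pow, mul_pow, mul_pow, Real.sq_sqrt (by positivity), Real.sq_sqrt (by positivity)]
    have h0 := norm_nonneg s
    calc ‖s‖ ^ 2 * (k + 1) = ‖s‖ * (‖s‖ * (k + 1)) := by ring
      _ ≤ (1 + ‖s‖) * (2 ^ 2 * (‖s‖ ^ 2 + 4 * (k + 1) ^ 2)) := by
        refine mul_le_mul (by linarith) ?_ (by positivity) (by positivity)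
        nlinarith [sq_nonneg (‖s‖ - (k + 1))]
      _ ≤ _ := by gcongr
  calc ‖s‖ * ((k + 1) * Real.sqrt (k + 1)) = (‖s‖ * Real.sqrt (k + 1)) * (k + 1) := by ring
    _ ≤ (Real.sqrt (1 + ‖s‖) * (2 * ‖s + 2 * ((k : ℂ) + 1)‖)) * (k + 1) := by gcongr
    _ = _ := by ring

lemma summ_32 : Summable (fun k : ℕ => 1 / ((k : ℝ) + 1) ^ (3 / 2 : ℝ)) := by
  have := (summable_nat_add_iff 1).2 (Real.summable_one_div_nat_rpow.2
    (show (1 : ℝ) < 3 / 2 by norm_num))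
  simpa using this

lemma Psi_bound : ∃ C : ℝ, 0 ≤ C ∧ ∀ s : ℂ, 0 ≤ s.re → ‖Psi s‖ ≤ C * Real.sqrt (1 + ‖s‖) := by
  set A := ‖(-Real.eulerMascheroniConstant / 2 - Real.log Real.pi / 2 : ℂ)‖
  set B := ∑' k : ℕ, 1 / ((k : ℝ) + 1) ^ (3 / 2 : ℝ)
  refine ⟨A + B, add_nonneg (norm_nonneg _) (tsum_nonneg fun k => by positivity), fun s hs => ?_⟩
  have h1 : 1 ≤ Real.sqrt (1 + ‖s‖) := by
    rw [Real.one_le_sqrt]; linarith [norm_nonneg s]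
  have h2 : ‖∑' k : ℕ, (1 / (2 * ((k : ℂ) + 1)) - 1 / (s + 2 * (k + 1)))‖ ≤
      Real.sqrt (1 + ‖s‖) * B := by
    have hs' := summ_32.mul_left (Real.sqrt (1 + ‖s‖))
    refine (tsum_of_norm_bounded hs'.hasSum (Psi_term_bound hs)).trans ?_
    rw [tsum_mul_left]
  calc ‖Psi s‖ ≤ A + Real.sqrt (1 + ‖s‖) * B := (norm_add_le _ _).trans (add_le_add le_rfl h2)
    _ ≤ A * Real.sqrt (1 + ‖s‖) + Real.sqrt (1 + ‖s‖) * B := by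
      gcongr
      exact le_mul_of_one_le_right (norm_nonneg _) h1
    _ = _ := by ring

end PMZ


namespace PMZ
open Filter Topology Set

noncomputable def Lg (y r : ℝ) : ℝ := Real.log (r ^ 2 + y ^ 2) / 2
noncomputable def phi (y r : ℝ) : ℝ := r / (r ^ 2 + y ^ 2)

lemma Lg_hasDerivAt {y : ℝ} (hy : 0 < y) (r : ℝ) : HasDerivAt (Lg y) (phi y r) r := by
  have h1 : HasDerivAt (fun r : ℝ => r ^ 2 + y ^ 2) (2 * r) r := by
    simpa using (hasDerivAt_pow 2 r).add_const (y ^ 2)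
  have h2 := (h1.log (by positivity)).div_const 2
  convert! h2 using 1
  unfold phi; field_simp

lemma phi_diff {y a r : ℝ} (hy : 0 < y) (ha : 1 ≤ a) (hr0 : 0 ≤ r) (hr : r ≤ 1 / 2) :
    |phi y (a + r) + phi y (a - r) - 2 * phi y a| ≤ 4 * r ^ 2 * (1 / (y * (a ^ 2 + y ^ 2))) := by
  have e : phi y (a + r) + phi y (a - r) - 2 * phi y a =
      2 * r ^ 2 * (a * (a ^ 2 - 3 * y ^ 2 - r ^ 2)) /
        (((a + r) ^ 2 + y ^ 2) * ((a - r) ^ 2 + y ^ 2) * (a ^ 2 + y ^ 2)) := by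
    unfold phi; field_simp; ring
  have hA : (0 : ℝ) < a ^ 2 + y ^ 2 := by positivity
  have hP : (a ^ 2 + y ^ 2) ^ 2 ≤ 4 * (((a + r) ^ 2 + y ^ 2) * ((a - r) ^ 2 + y ^ 2)) := by
    have h1 : a ^ 2 + y ^ 2 ≤ (a + r) ^ 2 + y ^ 2 := by nlinarith
    have h2 : a ^ 2 + y ^ 2 ≤ 4 * ((a - r) ^ 2 + y ^ 2) := by nlinarith [sq_nonneg y]
    calc (a ^ 2 + y ^ 2) ^ 2 = (a ^ 2 + y ^ 2) * (a ^ 2 + y ^ 2) := by ring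
      _ ≤ ((a + r) ^ 2 + y ^ 2) * (4 * ((a - r) ^ 2 + y ^ 2)) := by gcongr
      _ = _ := by ring
  set P := ((a + r) ^ 2 + y ^ 2) * ((a - r) ^ 2 + y ^ 2) with hPdef
  have hPpos : 0 < P := by positivity
  have hnum : (a * (a ^ 2 - 3 * y ^ 2 - r ^ 2)) ^ 2 ≤ (a ^ 2 + y ^ 2) * P := by
    rw [hPdef]
    have : (a ^ 2 + y ^ 2) * (((a + r) ^ 2 + y ^ 2) * ((a - r) ^ 2 + y ^ 2)) -
      (a * (a ^ 2 - 3 * y ^ 2 - r ^ 2)) ^ 2 = (y * (3 * a ^ 2 - y ^ 2 - r ^ 2)) ^ 2 := by ring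
    nlinarith [sq_nonneg (y * (3 * a ^ 2 - y ^ 2 - r ^ 2))]
  have hnum2 : |a * (a ^ 2 - 3 * y ^ 2 - r ^ 2)| * y ≤ 2 * P := by
    have h0 : (|a * (a ^ 2 - 3 * y ^ 2 - r ^ 2)| * y) ^ 2 ≤ (2 * P) ^ 2 := by
      rw [mul_pow, sq_abs]
      calc _ ≤ ((a ^ 2 + y ^ 2) * P) * (a ^ 2 + y ^ 2) :=
            mul_le_mul hnum (by nlinarith) (by positivity) (by positivity)
        _ = (a ^ 2 + y ^ 2) ^ 2 * P := by ring
        _ ≤ 4 * P * P := by gcongr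
        _ = _ := by ring
    exact le_of_sq_le_sq h0 (by positivity)
  rw [e, abs_div, abs_mul, abs_of_nonneg (by positivity : 0 ≤ 2 * r ^ 2),
    abs_of_pos (by positivity : 0 < P * (a ^ 2 + y ^ 2)), mul_one_div,
    div_le_div_iff₀ (by positivity) (by positivity)]
  calc 2 * r ^ 2 * |a * (a ^ 2 - 3 * y ^ 2 - r ^ 2)| * (y * (a ^ 2 + y ^ 2))
      = 2 * r ^ 2 * (a ^ 2 + y ^ 2) * (|a * (a ^ 2 - 3 * y ^ 2 - r ^ 2)| * y) := by ring
    _ ≤ 2 * r ^ 2 * (a ^ 2 + y ^ 2) * (2 * P) := by gcongr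
    _ = _ := by ring

lemma mid_err {y a : ℝ} (hy : 0 < y) (ha : 1 ≤ a) :
    |Lg y (a + 1 / 2) - Lg y (a - 1 / 2) - phi y a| ≤ 1 / (6 * (y * (a ^ 2 + y ^ 2))) := by
  set M := 1 / (y * (a ^ 2 + y ^ 2)) with hM
  have hd : ∀ r : ℝ, HasDerivAt (fun r => Lg y (a + r) - Lg y (a - r) - 2 * r * phi y a)
      (phi y (a + r) + phi y (a - r) - 2 * phi y a) r := by
    intro r
    have h1 := (Lg_hasDerivAt hy (a + r)).comp_const_add a r
    have h2 := (Lg_hasDerivAt hy (a - r)).comp_const_sub a r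
    have h3 : HasDerivAt (fun r : ℝ => 2 * r * phi y a) (2 * phi y a) r := by
      simpa using ((hasDerivAt_id r).const_mul 2).mul_const (phi y a)
    convert! (h1.sub h2).sub h3 using 1
    ring
  have hB : ∀ r : ℝ, HasDerivAt (fun r => 4 / 3 * r ^ 3 * M) (4 * r ^ 2 * M) r := by
    intro r
    have := ((hasDerivAt_pow 3 r).const_mul (4 / 3)).mul_const M
    convert! this using 1
    push_cast; ring
  have := image_norm_le_of_norm_deriv_right_le_deriv_boundary (a := 0) (b := 1 / 2)
    (f := fun r => Lg y (a + r) - Lg y (a - r) - 2 * r * phi y a)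
    (fun r _ => (hd r).continuousAt.continuousWithinAt)
    (fun r _ => (hd r).hasDerivWithinAt) (B := fun r => 4 / 3 * r ^ 3 * M)
    (by simp) hB
    (fun r hr => by
      rw [Real.norm_eq_abs]; exact phi_diff hy ha hr.1 hr.2.le)
    (x := 1 / 2) ⟨by norm_num, le_rfl⟩
  rw [Real.norm_eq_abs] at this
  have e : Lg y (a + 1 / 2) - Lg y (a - 1 / 2) - phi y a =
      Lg y (a + 1 / 2) - Lg y (a - 1 / 2) - 2 * (1 / 2) * phi y a := by ring
  rw [e]
  refine this.trans (le_of_eq ?_)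
  rw [hM]; field_simp; norm_num

lemma sum_err {y σ : ℝ} (hy : 0 < y) (hσ : 0 ≤ σ) (N : ℕ) :
    |Lg y (N + 1 / 2 + σ) - Lg y (1 / 2 + σ) - ∑ k ∈ Finset.range N, phi y (k + 1 + σ)|
      ≤ 1 / (3 * y) * (1 / (σ + y) - 1 / (N + σ + y)) := by
  induction N with
  | zero => simp
  | succ n ih =>
    have hn : (0 : ℝ) ≤ n := by positivity
    have h := mid_err (y := y) (a := n + 1 + σ) hy (by linarith)
    rw [Finset.sum_range_succ]
    have e : Lg y ((n + 1 : ℕ) + 1 / 2 + σ) - Lg y (1 / 2 + σ) -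
        (∑ k ∈ Finset.range n, phi y (k + 1 + σ) + phi y (n + 1 + σ)) =
        (Lg y (n + 1 / 2 + σ) - Lg y (1 / 2 + σ) - ∑ k ∈ Finset.range n, phi y (k + 1 + σ)) +
        (Lg y (n + 1 + σ + 1 / 2) - Lg y (n + 1 + σ - 1 / 2) - phi y (n + 1 + σ)) := by
      have h1 : ((n + 1 : ℕ) : ℝ) + 1 / 2 + σ = n + 1 + σ + 1 / 2 := by push_cast; ring
      have h2 : (n : ℝ) + 1 + σ - 1 / 2 = n + 1 / 2 + σ := by ring
      rw [h1, h2]; ring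
    rw [e]
    refine (abs_add_le _ _).trans ((add_le_add ih h).trans ?_)
    have h3 : 1 / (6 * (y * (((n : ℝ) + 1 + σ) ^ 2 + y ^ 2))) ≤
        1 / (3 * y) * (1 / (n + σ + y) - 1 / (n + 1 + σ + y)) := by
      have hp : 0 < (n : ℝ) + σ + y := by positivity
      have e2 : 1 / (3 * y) * (1 / (n + σ + y) - 1 / (n + 1 + σ + y)) =
        1 / (3 * y * ((n + σ + y) * (n + 1 + σ + y))) := by field_simp; ring
      rw [e2]
      apply one_div_le_one_div_of_le (by positivity)
      have : ((n : ℝ) + σ + y) * (n + 1 + σ + y) ≤ 2 * ((n + 1 + σ) ^ 2 + y ^ 2) := by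
        nlinarith [sq_nonneg ((n : ℝ) + 1 + σ - y)]
      nlinarith [mul_le_mul_of_nonneg_left this hy.le]
    push_cast
    nlinarith [h3]

lemma Lg_tendsto {y σ : ℝ} (hy : 0 < y) (hσ : 0 ≤ σ) :
    Tendsto (fun N : ℕ => Lg y (N + 1 / 2 + σ) - Real.log N) atTop (𝓝 0) := by
  have h1 : Tendsto (fun N : ℕ => Real.log ((1 + (1 / 2 + σ) * (N : ℝ)⁻¹) ^ 2
      + (y * (N : ℝ)⁻¹) ^ 2) / 2) atTop (𝓝 0) := by
    have h0 : Tendsto (fun N : ℕ => (N : ℝ)⁻¹) atTop (𝓝 0) := tendsto_inv_atTop_nhds_zero_nat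
    have h2 : Tendsto (fun N : ℕ => (1 + (1 / 2 + σ) * (N : ℝ)⁻¹) ^ 2
      + (y * (N : ℝ)⁻¹) ^ 2) atTop (𝓝 ((1 + (1 / 2 + σ) * 0) ^ 2 + (y * 0) ^ 2)) :=
      (((h0.const_mul _).const_add 1).pow 2).add ((h0.const_mul y).pow 2)
    have h3 := (h2.log (by norm_num)).div_const 2
    simpa using h3
  refine h1.congr' ?_
  filter_upwards [eventually_ne_atTop 0] with N hN
  have hN' : (0 : ℝ) < N := by positivity
  unfold Lg
  have : ((N : ℝ) + 1 / 2 + σ) ^ 2 + y ^ 2 =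
    N ^ 2 * ((1 + (1 / 2 + σ) * (N : ℝ)⁻¹) ^ 2 + (y * (N : ℝ)⁻¹) ^ 2) := by
    field_simp
    ring
  rw [this, Real.log_mul (by positivity) (by positivity), Real.log_pow]
  push_cast; ring

lemma gkd_re {σ y : ℝ} (k : ℕ) :
    (gkd k ⟨σ, y⟩).re = 1 / ((k : ℝ) + 1) - phi y (k + 1 + σ) := by
  unfold gkd phi
  have e1 : (1 / ((k : ℂ) + 1)).re = 1 / ((k : ℝ) + 1) := by
    have : (1 / ((k : ℂ) + 1)) = ((1 / ((k : ℝ) + 1) : ℝ) : ℂ) := by push_cast; rfl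
    rw [this, ofReal_re]
  rw [sub_re, e1, one_div ((k : ℂ) + 1 + ⟨σ, y⟩), inv_re, normSq_apply]
  simp [sq]

theorem digamma_re_bound {y σ : ℝ} (hy : 0 < y) (hσ : 0 ≤ σ) (hσ2 : σ ≤ 1 / 2) :
    |(-Real.eulerMascheroniConstant + ∑' k, gkd k ⟨σ, y⟩ : ℂ).re - Real.log y| ≤ 1 / y ^ 2 := by
  have hs : Summable (fun k => gkd k ⟨σ, y⟩) := gkd_summable (by simp; linarith)
  have hre : Tendsto (fun N : ℕ => ∑ k ∈ Finset.range N, (gkd k ⟨σ, y⟩).re) atTop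
      (𝓝 (∑' k, gkd k ⟨σ, y⟩ : ℂ).re) := by
    have := (hasSum_re hs.hasSum).tendsto_sum_nat
    exact this
  have hH := Real.tendsto_harmonic_sub_log
  have hL := Lg_tendsto hy hσ
  have hlim : Tendsto (fun N : ℕ => Lg y (N + 1 / 2 + σ) - Lg y (1 / 2 + σ) -
      ∑ k ∈ Finset.range N, phi y (k + 1 + σ)) atTop
      (𝓝 ((∑' k, gkd k ⟨σ, y⟩ : ℂ).re - Real.eulerMascheroniConstant + 0 - Lg y (1 / 2 + σ))) := by
    refine (((hre.sub hH).add hL).sub_const (Lg y (1 / 2 + σ))).congr fun N => ?_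
    simp_rw [gkd_re]
    rw [Finset.sum_sub_distrib]
    simp [harmonic]
    ring
  have hb : |(∑' k, gkd k ⟨σ, y⟩ : ℂ).re - Real.eulerMascheroniConstant + 0 - Lg y (1 / 2 + σ)|
      ≤ 1 / (3 * y ^ 2) := by
    refine le_of_tendsto hlim.abs (Eventually.of_forall fun N => ?_)
    refine (sum_err hy hσ N).trans ?_
    have h1 : 1 / (σ + y) ≤ 1 / y := one_div_le_one_div_of_le hy (by linarith)
    have h2 : 0 ≤ 1 / ((N : ℝ) + σ + y) := by positivity
    calc 1 / (3 * y) * (1 / (σ + y) - 1 / (N + σ + y)) ≤ 1 / (3 * y) * (1 / y) := by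
          gcongr; linarith
      _ = _ := by field_simp
  have hLg1 : Real.log y ≤ Lg y (1 / 2 + σ) := by
    unfold Lg
    have : Real.log (y ^ 2) ≤ Real.log ((1 / 2 + σ) ^ 2 + y ^ 2) :=
      Real.log_le_log (by positivity) (by nlinarith)
    rw [Real.log_pow] at this
    push_cast at this; linarith
  have hLg2 : Lg y (1 / 2 + σ) ≤ Real.log y + 1 / (2 * y ^ 2) := by
    unfold Lg
    have e : (1 / 2 + σ) ^ 2 + y ^ 2 = y ^ 2 * (1 + (1 / 2 + σ) ^ 2 / y ^ 2) := by field_simp; ring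
    rw [e, Real.log_mul (by positivity) (by positivity), Real.log_pow]
    have h1 := Real.log_le_sub_one_of_pos (x := 1 + (1 / 2 + σ) ^ 2 / y ^ 2) (by positivity)
    have h2 : (1 / 2 + σ) ^ 2 / y ^ 2 ≤ 1 / y ^ 2 := by
      gcongr; nlinarith
    have h3 : 1 / (2 * y ^ 2) = (1 / y ^ 2) / 2 := by field_simp
    rw [h3]; push_cast; linarith
  have e1 : (-Real.eulerMascheroniConstant + ∑' k, gkd k ⟨σ, y⟩ : ℂ).re =
    (∑' k, gkd k ⟨σ, y⟩ : ℂ).re - Real.eulerMascheroniConstant := by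
    rw [add_re, neg_re, ofReal_re]; ring
  rw [e1]
  have h3 : 1 / (2 * y ^ 2) = (1 / y ^ 2) / 2 := by field_simp
  have h4 : 1 / (3 * y ^ 2) = (1 / y ^ 2) / 3 := by field_simp
  rw [h3] at hLg2; rw [h4] at hb
  have h5 : 0 < 1 / y ^ 2 := by positivity
  rw [abs_le] at hb ⊢
  constructor <;> linarith [hb.1, hb.2]

theorem Psi_re_bound {t σ : ℝ} (ht : 0 < t) (hσ : 0 ≤ σ) (hσ2 : σ ≤ 1) :
    |(Psi (σ + t * I)).re - (Real.log t - Real.log (2 * Real.pi)) / 2| ≤ 2 / t ^ 2 := by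
  have h := digamma_re_bound (y := t / 2) (σ := σ / 2) (by positivity) (by positivity) (by linarith)
  have e0 : ((σ + t * I : ℂ) / 2) = ⟨σ / 2, t / 2⟩ := by
    apply Complex.ext <;> simp
  rw [Psi_eq (by simp; linarith), e0]
  have e1 : ((-(Real.eulerMascheroniConstant : ℂ) + ∑' k, gkd k ⟨σ / 2, t / 2⟩) / 2
      - (Real.log Real.pi : ℂ) / 2).re =
      (-(Real.eulerMascheroniConstant : ℂ) + ∑' k, gkd k ⟨σ / 2, t / 2⟩).re / 2
        - Real.log Real.pi / 2 := by
    rw [sub_re]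
    congr 1
    · have := div_ofReal_re (-(Real.eulerMascheroniConstant : ℂ) + ∑' k, gkd k ⟨σ / 2, t / 2⟩) 2
      simpa using this
    · have := div_ofReal_re (Real.log Real.pi : ℂ) 2
      rw [ofReal_re] at this
      simpa using this
  rw [e1]
  rw [Real.log_div ht.ne' two_ne_zero] at h
  rw [Real.log_mul two_ne_zero Real.pi_ne_zero]
  have e2 : 1 / (t / 2) ^ 2 = 2 * (2 / t ^ 2) := by field_simp
  rw [e2] at h
  rw [abs_le] at h ⊢
  constructor <;> linarith [h.1, h.2]

end PMZ


namespace PMZ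
open Filter Topology Set

noncomputable def EE (s : ℂ) : ℂ :=
  -(s / 2) * Real.log Real.pi + (-(s / 2) * Real.eulerMascheroniConstant + ∑' k, gk k (s / 2))

lemma Gfun_eq_exp {s : ℂ} (hs : -1 < s.re) : Gfun s = exp (EE s) := by
  unfold Gfun EE
  rw [Gamma_add_one_eq (half_re hs), cpow_def_of_ne_zero (by exact_mod_cast Real.pi_ne_zero),
    ← ofReal_log Real.pi_pos.le, ← exp_add]
  congr 1; ring

lemma EE_zero : EE 0 = 0 := by simp [EE, gk_zero]

lemma EE_hasDerivAt {s : ℂ} (hs : -1 < s.re) : HasDerivAt EE (Psi s) s := by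
  have h1 : HasDerivAt (fun s : ℂ => s / 2) (1 / 2) s := (hasDerivAt_id s).div_const 2
  have h2 := (gk_tsum_hasDerivAt (half_re hs)).comp s h1
  have h3 := (h1.neg.mul_const (Real.log Real.pi : ℂ)).add
    ((h1.neg.mul_const (Real.eulerMascheroniConstant : ℂ)).add h2)
  convert! h3 using 1
  rw [Psi_eq hs]; ring

lemma EE_bound : ∃ C : ℝ, 0 ≤ C ∧ ∀ s : ℂ, 0 ≤ s.re → ‖EE s‖ ≤ C * (1 + ‖s‖) ^ (3 / 2 : ℝ) := by
  obtain ⟨C, hC, hP⟩ := Psi_bound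
  refine ⟨C, hC, fun s hs => ?_⟩
  have hconv : Convex ℝ ({w : ℂ | 0 ≤ w.re} ∩ Metric.closedBall 0 ‖s‖) :=
    (convex_halfSpace_re_ge 0).inter (convex_closedBall 0 _)
  have := hconv.norm_image_sub_le_of_norm_hasDerivWithin_le (f := EE) (f' := Psi)
    (C := C * Real.sqrt (1 + ‖s‖)) (x := 0) (y := s)
    (fun w hw => (EE_hasDerivAt (by have : 0 ≤ w.re := hw.1; linarith)).hasDerivWithinAt)
    (fun w hw => (hP w hw.1).trans (by
      have h2 : ‖w‖ ≤ ‖s‖ := by simpa using hw.2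
      gcongr)) ⟨by simp, by simp⟩ ⟨hs, by simp⟩
  rw [EE_zero, sub_zero, sub_zero] at this
  refine this.trans ?_
  have h1 : (1 + ‖s‖) ^ (3 / 2 : ℝ) = Real.sqrt (1 + ‖s‖) * (1 + ‖s‖) := by
    rw [Real.sqrt_eq_rpow, ← Real.rpow_add_one (by positivity)]; norm_num
  rw [h1, mul_assoc]
  gcongr
  linarith

noncomputable def XI (s : ℂ) : ℂ := s * (s - 1) * completedRiemannZeta₀ s + 1

lemma XI_differentiable : Differentiable ℂ XI := by
  unfold XI
  exact (((differentiable_id.mul (differentiable_id.sub_const 1)).mul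
    differentiable_completedZeta₀).add_const 1)

lemma XI_one : XI 1 = 1 := by simp [XI]

lemma XI_one_sub (s : ℂ) : XI (1 - s) = XI s := by
  unfold XI
  rw [completedRiemannZeta₀_one_sub]; ring

lemma XI_eq {s : ℂ} (h0 : 0 < s.re) (h1 : s ≠ 1) :
    XI s = 2 * (s - 1) * Gfun s * riemannZeta s := by
  have hs0 : s ≠ 0 := by rintro rfl; simp at h0
  have h1' : 1 - s ≠ 0 := sub_ne_zero.2 h1.symm
  have hG : Gammaℝ s ≠ 0 := Gammaℝ_ne_zero_of_re_pos h0
  have e : completedRiemannZeta₀ s = riemannZeta s * Gammaℝ s + 1 / s + 1 / (1 - s) := by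
    rw [riemannZeta_def_of_ne_zero hs0, div_mul_cancel₀ _ hG, completedRiemannZeta_eq]; ring
  have e2 : s * Gammaℝ s = 2 * Gfun s := by
    unfold Gfun
    rw [Gammaℝ_def, Gamma_add_one _ (div_ne_zero hs0 two_ne_zero)]; ring
  unfold XI
  rw [e]
  have : s * (s - 1) * (riemannZeta s * Gammaℝ s + 1 / s + 1 / (1 - s)) + 1 =
      (s - 1) * (s * Gammaℝ s) * riemannZeta s := by field_simp; ring
  rw [this, e2]; ring

lemma XI_conj {s : ℂ} (h0 : 0 < s.re) (h1 : s ≠ 1) :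
    XI ((starRingEnd ℂ) s) = (starRingEnd ℂ) (XI s) := by
  have hs1 : (starRingEnd ℂ) s ≠ 1 := by
    intro h; apply h1; have := congrArg (starRingEnd ℂ) h; simpa using this
  rw [XI_eq (by simpa using h0) hs1, XI_eq h0 h1, riemannZeta_conj]
  have e : Gfun ((starRingEnd ℂ) s) = (starRingEnd ℂ) (Gfun s) := by
    unfold Gfun
    have hp : (Real.pi : ℂ) ^ ((starRingEnd ℂ) (-s / 2)) =
        (starRingEnd ℂ) ((Real.pi : ℂ) ^ (-s / 2)) := by
      rw [cpow_conj _ _ (by rw [arg_ofReal_of_nonneg Real.pi_pos.le]; exact Real.pi_pos.ne),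
        conj_ofReal]
    rw [map_mul, ← Gamma_conj, ← hp, map_add, map_div₀, map_div₀, map_neg, map_one,
      map_ofNat (starRingEnd ℂ) 2]
  rw [e, map_mul, map_mul, map_mul, map_sub, map_one, map_ofNat (starRingEnd ℂ) 2]

lemma XI_ne_zero (RH : RiemannHypothesis) {s : ℂ} (hs : 1 / 2 < s.re) : XI s ≠ 0 := by
  rcases eq_or_ne s 1 with rfl | h1
  · rw [XI_one]; exact one_ne_zero
  · rw [XI_eq (by linarith) h1]
    refine mul_ne_zero (mul_ne_zero (mul_ne_zero two_ne_zero (sub_ne_zero.2 h1))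
      (Gfun_ne_zero (by linarith))) ?_
    intro h
    have := RH s h (by
      rintro ⟨n, rfl⟩
      have : (-2 * ((n : ℂ) + 1)).re = -2 * ((n : ℝ) + 1) := by simp
      rw [this] at hs
      have hn : (0 : ℝ) ≤ n := by positivity
      linarith) h1
    linarith

lemma Lser_bound (f : ℕ → ℂ) {σ : ℝ} (hf : LSeriesSummable f σ) :
    ∃ C : ℝ, 0 ≤ C ∧ ∀ s : ℂ, σ ≤ s.re → ‖LSeries f s‖ ≤ C := by
  refine ⟨∑' n, ‖LSeries.term f σ n‖, tsum_nonneg fun n => norm_nonneg _, fun s hs => ?_⟩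
  have h : ∀ n, ‖LSeries.term f s n‖ ≤ ‖LSeries.term f σ n‖ := fun n =>
    LSeries.norm_term_le_of_re_le_re f (by simpa using hs) n
  exact tsum_of_norm_bounded hf.norm.hasSum h

lemma zeta_bound : ∃ C : ℝ, 1 ≤ C ∧ ∀ s : ℂ, 5 / 4 ≤ s.re →
    ‖riemannZeta s‖ ≤ C ∧ C⁻¹ ≤ ‖riemannZeta s‖ := by
  obtain ⟨C1, h1, hb1⟩ := Lser_bound (fun n => ((ArithmeticFunction.zeta n : ℕ) : ℂ)) (σ := 5 / 4)
    (ArithmeticFunction.LSeriesSummable_zeta_iff.2 (by norm_num))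
  obtain ⟨C2, h2, hb2⟩ := Lser_bound (fun n => ((ArithmeticFunction.moebius n : ℤ) : ℂ)) (σ := 5 / 4)
    (ArithmeticFunction.LSeriesSummable_moebius_iff.2 (by norm_num))
  refine ⟨C1 + C2 + 1, by linarith, fun s hs => ?_⟩
  have hs1 : 1 < s.re := by linarith
  have hz := ArithmeticFunction.LSeries_zeta_eq_riemannZeta hs1
  have hm := ArithmeticFunction.LSeries_zeta_mul_Lseries_moebius hs1
  have b1 := hb1 s hs
  have b2 := hb2 s hs
  rw [hz] at b1 hm
  refine ⟨by linarith, ?_⟩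
  have h3 := congrArg norm hm
  rw [norm_mul, norm_one] at h3
  have hpos : 0 < ‖riemannZeta s‖ := by
    rw [norm_pos_iff]; exact riemannZeta_ne_zero_of_one_lt_re hs1
  rw [inv_le_iff_one_le_mul₀ (by linarith), ← h3]
  gcongr
  linarith

lemma L0_bound : ∃ C : ℝ, 0 ≤ C ∧ ∀ s : ℂ, 0 ≤ s.re → s.re ≤ 4 →
    ‖completedRiemannZeta₀ s‖ ≤ C := by
  set P := HurwitzZeta.hurwitzEvenFEPair 0
  have hM : ∀ s : ℂ, MellinConvergent P.f_modif s := fun s =>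
    (P.isStrongFEPair_toStrongFEPair.hasMellin s).1
  have h0 := (hM 0).norm
  have h2 := (hM 2).norm
  refine ⟨(∫ x in Ioi (0 : ℝ), (‖(x : ℂ) ^ ((0 : ℂ) - 1) • P.f_modif x‖
    + ‖(x : ℂ) ^ ((2 : ℂ) - 1) • P.f_modif x‖)) / 2, ?_, fun s hs hs4 => ?_⟩
  · refine div_nonneg (MeasureTheory.integral_nonneg fun x => by positivity) (by norm_num)
  · have e : completedRiemannZeta₀ s = mellin P.f_modif (s / 2) / 2 := rfl
    rw [e, norm_div, norm_ofNat]
    gcongr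
    unfold mellin
    refine MeasureTheory.norm_integral_le_of_norm_le (h0.add h2) ?_
    filter_upwards [MeasureTheory.ae_restrict_mem measurableSet_Ioi] with x hx
    have hx0 : (0 : ℝ) < x := hx
    have hre : (s / 2).re = s.re / 2 := by
      have := div_ofReal_re s 2
      simpa using this
    simp only [norm_smul, norm_cpow_eq_rpow_re_of_pos hx0, sub_re, hre, one_re, zero_re,
      Pi.add_apply, re_ofNat]
    rw [← add_mul]
    gcongr
    rcases le_total x 1 with hx1 | hx1
    · refine le_add_of_le_of_nonneg (Real.rpow_le_rpow_of_exponent_ge hx0 hx1 (by linarith))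
        (by positivity)
    · refine le_add_of_nonneg_of_le (by positivity)
        (Real.rpow_le_rpow_of_exponent_le hx1 (by linarith))

end PMZ


namespace PMZ
open Filter Topology Set

lemma exists_log {f : ℂ → ℂ} {R : ℝ} (hR : 0 < R) (hf : DifferentiableOn ℂ f (Metric.ball 0 R))
    (hne : ∀ z ∈ Metric.ball (0 : ℂ) R, f z ≠ 0) :
    ∃ g : ℂ → ℂ, DifferentiableOn ℂ g (Metric.ball 0 R) ∧ g 0 = 0 ∧
      ∀ z ∈ Metric.ball (0 : ℂ) R, f z = f 0 * exp (g z) := by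
  have hd : DifferentiableOn ℂ (fun z => deriv f z / f z) (Metric.ball 0 R) :=
    (hf.deriv Metric.isOpen_ball).div hf hne
  obtain ⟨F, hF⟩ := hd.isExactOn_ball
  refine ⟨fun z => F z - F 0, fun z hz => ((hF z hz).sub_const _).differentiableAt.differentiableWithinAt,
    by simp, ?_⟩
  have hder : ∀ z ∈ Metric.ball (0 : ℂ) R, HasDerivAt (fun z => f z * exp (-(F z - F 0))) 0 z := by
    intro z hz
    have h1 : HasDerivAt f (deriv f z) z :=
      (hf.differentiableAt (Metric.isOpen_ball.mem_nhds hz)).hasDerivAt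
    have h2 := ((hF z hz).sub_const (F 0)).neg.cexp
    convert! h1.mul h2 using 1
    have := hne z hz
    field_simp; ring
  intro z hz
  have := Metric.isOpen_ball.is_const_of_deriv_eq_zero (convex_ball (0 : ℂ) R).isPreconnected
    (fun w hw => (hder w hw).differentiableAt.differentiableWithinAt)
    (fun w hw => (hder w hw).deriv) hz (Metric.mem_ball_self hR)
  simp only [sub_self, neg_zero, exp_zero, mul_one] at this
  rw [← this, mul_assoc, ← exp_add]; simp

lemma one_le_A (s : ℂ) : 1 + ‖s‖ ≤ (1 + ‖s‖) ^ (3 / 2 : ℝ) := by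
  have h : (1 : ℝ) ≤ 1 + ‖s‖ := by linarith [norm_nonneg s]
  calc 1 + ‖s‖ = (1 + ‖s‖) ^ (1 : ℝ) := (Real.rpow_one _).symm
    _ ≤ _ := Real.rpow_le_rpow_of_exponent_le h (by norm_num)

lemma XI_right : ∃ C : ℝ, 0 ≤ C ∧ ∀ s : ℂ, 5 / 4 ≤ s.re →
    ‖XI s‖ ≤ Real.exp (C * (1 + ‖s‖) ^ (3 / 2 : ℝ)) ∧
    Real.exp (-(C * (1 + ‖s‖) ^ (3 / 2 : ℝ))) ≤ ‖XI s‖ := by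
  obtain ⟨C1, hC1, h1⟩ := EE_bound
  obtain ⟨Z, hZ, h2⟩ := zeta_bound
  refine ⟨C1 + 1 + 2 * Z, by linarith, fun s hs => ?_⟩
  have hA := one_le_A s
  set A := (1 + ‖s‖) ^ (3 / 2 : ℝ) with hAdef
  have hA1 : 1 ≤ A := by linarith [norm_nonneg s]
  have hs1 : s ≠ 1 := by rintro rfl; norm_num at hs
  obtain ⟨hz1, hz2⟩ := h2 s hs
  have hE := h1 s (by linarith)
  have hn : ‖XI s‖ = 2 * ‖s - 1‖ * Real.exp (EE s).re * ‖riemannZeta s‖ := by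
    rw [XI_eq (by linarith) hs1, Gfun_eq_exp (by linarith)]
    simp [norm_exp]
  have hre := abs_le.1 ((abs_re_le_norm (EE s)).trans hE)
  have hZA : 2 * Z ≤ Real.exp (2 * Z * A) := by
    have := Real.add_one_le_exp (2 * Z * A)
    nlinarith
  rw [hn]
  constructor
  · have hu : ‖s - 1‖ ≤ Real.exp A := by
      have := Real.add_one_le_exp A
      have h3 := norm_sub_le s 1
      rw [norm_one] at h3; linarith
    calc 2 * ‖s - 1‖ * Real.exp (EE s).re * ‖riemannZeta s‖
        ≤ 2 * Real.exp A * Real.exp (C1 * A) * Z := by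
          gcongr; exact hre.2
      _ = Real.exp A * Real.exp (C1 * A) * (2 * Z) := by ring
      _ ≤ Real.exp A * Real.exp (C1 * A) * Real.exp (2 * Z * A) := by gcongr
      _ = _ := by rw [← Real.exp_add, ← Real.exp_add]; congr 1; ring
  · have hl : 1 / 4 ≤ ‖s - 1‖ := by
      refine le_trans ?_ (re_le_norm _)
      rw [sub_re, one_re]; linarith
    calc Real.exp (-((C1 + 1 + 2 * Z) * A))
        ≤ Real.exp (-(C1 * A)) * (Real.exp (2 * Z * A))⁻¹ := by
          rw [← Real.exp_neg, ← Real.exp_add]; apply Real.exp_le_exp.2; nlinarith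
      _ ≤ Real.exp (-(C1 * A)) * (2 * Z)⁻¹ := by gcongr
      _ = 2 * (1 / 4) * Real.exp (-(C1 * A)) * Z⁻¹ := by rw [mul_inv]; ring
      _ ≤ _ := by gcongr; exact hre.1

lemma XI_upper : ∃ C : ℝ, 0 ≤ C ∧ ∀ s : ℂ, 0 ≤ s.re →
    ‖XI s‖ ≤ Real.exp (C * (1 + ‖s‖) ^ (3 / 2 : ℝ)) := by
  obtain ⟨C1, hC1, h1⟩ := XI_right
  obtain ⟨C0, hC0, h0⟩ := L0_bound
  refine ⟨C1 + (C0 + 1 + 2), by linarith, fun s hs => ?_⟩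
  have hA := one_le_A s
  set A := (1 + ‖s‖) ^ (3 / 2 : ℝ) with hAdef
  have hA1 : 1 ≤ A := by linarith [norm_nonneg s]
  rcases le_total (5 / 4) s.re with h | h
  · refine (h1 s h).1.trans (Real.exp_le_exp.2 ?_)
    gcongr; linarith
  · have hb := h0 s hs (by linarith)
    have hn := norm_nonneg s
    have e1 : ‖XI s‖ ≤ (C0 + 1) * (1 + ‖s‖) ^ 2 := by
      unfold XI
      refine (norm_add_le _ _).trans ?_
      rw [norm_mul, norm_mul, norm_one]
      have h3 := norm_sub_le s 1
      rw [norm_one] at h3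
      calc ‖s‖ * ‖s - 1‖ * ‖completedRiemannZeta₀ s‖ + 1 ≤ ‖s‖ * (‖s‖ + 1) * C0 + 1 := by gcongr
        _ ≤ _ := by nlinarith [mul_nonneg hC0 hn]
    refine e1.trans ?_
    have h4 : (C0 + 1) ≤ Real.exp (C0 + 1) := by linarith [Real.add_one_le_exp (C0 + 1)]
    have h5 : (1 + ‖s‖) ≤ Real.exp A := by linarith [Real.add_one_le_exp A]
    calc (C0 + 1) * (1 + ‖s‖) ^ 2 ≤ Real.exp (C0 + 1) * Real.exp A ^ 2 := by gcongr
      _ = Real.exp (C0 + 1 + 2 * A) := by rw [← Real.exp_nat_mul, ← Real.exp_add]; norm_num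
      _ ≤ _ := Real.exp_le_exp.2 (by nlinarith)

lemma XI_lower (RH : RiemannHypothesis) {h : ℝ} (hh : 0 < h) :
    ∃ C : ℝ, 0 ≤ C ∧ ∀ s : ℂ, 1 / 2 + h ≤ s.re →
      Real.exp (-(C * (1 + ‖s‖) ^ (3 / 2 : ℝ))) ≤ ‖XI s‖ := by
  obtain ⟨C1, hC1, h1⟩ := XI_right
  obtain ⟨C2, hC2, h2⟩ := XI_upper
  set K : ℝ := 5 ^ (3 / 2 : ℝ) with hK
  have hK1 : 1 ≤ K := Real.one_le_rpow (by norm_num) (by norm_num)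
  refine ⟨C1 * K + 3 * (C1 + C2 + 1) * K / h, by positivity, fun s hs => ?_⟩
  set A := (1 + ‖s‖) ^ (3 / 2 : ℝ) with hAdef
  have hA1 : 1 ≤ A := Real.one_le_rpow (by linarith [norm_nonneg s]) (by norm_num)
  rcases le_total 2 s.re with hre | hre
  · refine le_trans (Real.exp_le_exp.2 (neg_le_neg ?_)) (h1 s (by linarith)).2
    have : 0 ≤ 3 * (C1 + C2 + 1) * K / h := by positivity
    have h3 : C1 ≤ C1 * K := by nlinarith
    have h4 : C1 ≤ C1 * K + 3 * (C1 + C2 + 1) * K / h := by linarith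
    gcongr
  set c : ℂ := ⟨2, s.im⟩ with hc
  have hbd : ∀ w : ℂ, ‖w‖ ≤ 4 + ‖s‖ → (1 + ‖w‖) ^ (3 / 2 : ℝ) ≤ K * A := by
    intro w hw
    rw [hK, hAdef, ← Real.mul_rpow (by norm_num) (by positivity)]
    apply Real.rpow_le_rpow (by positivity) _ (by norm_num)
    linarith [norm_nonneg s]
  have hcn : ‖c‖ ≤ 2 + ‖s‖ := by
    refine (norm_le_abs_re_add_abs_im c).trans ?_
    have := abs_im_le_norm s
    simp [hc]; linarith
  have hcb := hbd c (by linarith)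
  have hcl : Real.exp (-(C1 * (K * A))) ≤ ‖XI c‖ := by
    refine le_trans (Real.exp_le_exp.2 (neg_le_neg ?_)) (h1 c (by simp [hc]; norm_num)).2
    gcongr
  have hcre : ∀ z : ℂ, z ∈ Metric.ball (0 : ℂ) (3 / 2) → 1 / 2 < (c + z).re := by
    intro z hz
    have hz' : ‖z‖ < 3 / 2 := by simpa using hz
    have := (abs_lt.1 ((abs_re_le_norm z).trans_lt hz')).1
    rw [add_re]; simp only [hc]; linarith
  obtain ⟨g, hg, hg0, hgeq⟩ := exists_log (f := fun z => XI (c + z)) (R := 3 / 2) (by norm_num)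
    ((XI_differentiable.comp (differentiable_id.const_add c)).differentiableOn)
    (fun z hz => XI_ne_zero RH (hcre z hz))
  simp only [add_zero] at hgeq
  have hXc : XI c ≠ 0 := XI_ne_zero RH (by simp [hc]; norm_num)
  set M := (C1 + C2 + 1) * (K * A) with hM
  have hMpos : 0 < M := by positivity
  have hmaps : MapsTo g (Metric.ball 0 (3 / 2)) {z | z.re ≤ M} := by
    intro z hz
    have hz' : ‖z‖ < 3 / 2 := by simpa using hz
    have e := congrArg norm (hgeq z hz)
    rw [norm_mul, norm_exp] at e
    have hu := h2 (c + z) (by linarith [hcre z hz])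
    have hb2 := hbd (c + z) ((norm_add_le _ _).trans (by linarith))
    have hu2 : ‖XI (c + z)‖ ≤ Real.exp (C2 * (K * A)) :=
      hu.trans (Real.exp_le_exp.2 (by gcongr))
    rw [e] at hu2
    have h5 : Real.exp (-(C1 * (K * A))) * Real.exp (g z).re ≤ Real.exp (C2 * (K * A)) :=
      le_trans (by gcongr) hu2
    rw [← Real.exp_add, Real.exp_le_exp] at h5
    have h6 : 0 < K * A := by positivity
    change (g z).re ≤ M
    rw [hM]; nlinarith
  have hsz : ‖s - c‖ ≤ 3 / 2 - h := by
    have : s - c = ((s.re - 2 : ℝ) : ℂ) := by apply Complex.ext <;> simp [hc]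
    rw [this, norm_real, Real.norm_eq_abs, abs_le]
    constructor <;> linarith
  have hmem : s - c ∈ Metric.ball (0 : ℂ) (3 / 2) := by
    rw [mem_ball_zero_iff]; linarith
  have hBC := borelCaratheodory_zero hMpos hg hmaps (by norm_num) hmem hg0
  have hBC2 : ‖g (s - c)‖ ≤ 3 * M / h := by
    refine hBC.trans ?_
    rw [div_le_div_iff₀ (by linarith) hh]
    have h7 : h ≤ 3 / 2 - ‖s - c‖ := by linarith
    have h8 : ‖s - c‖ ≤ 3 / 2 := by linarith
    calc 2 * M * ‖s - c‖ * h ≤ 2 * M * (3 / 2) * (3 / 2 - ‖s - c‖) := by gcongr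
      _ = _ := by ring
  have e := congrArg norm (hgeq _ hmem)
  rw [norm_mul, norm_exp, add_sub_cancel] at e
  rw [e]
  have hlow := (abs_le.1 ((abs_re_le_norm _).trans hBC2)).1
  calc Real.exp (-((C1 * K + 3 * (C1 + C2 + 1) * K / h) * A))
      = Real.exp (-(C1 * (K * A))) * Real.exp (-(3 * M / h)) := by
        rw [← Real.exp_add]; congr 1; rw [hM]; ring
    _ ≤ _ := by gcongr

end PMZ


namespace PMZ
open Filter Topology Set

lemma Gfun_real_norm (x : ℝ) (hx : 0 ≤ x) :
    ‖Gfun x‖ = Real.pi ^ (-x / 2) * Real.Gamma (x / 2 + 1) := by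
  have e : Gfun x = ((Real.pi ^ (-x / 2) * Real.Gamma (x / 2 + 1) : ℝ) : ℂ) := by
    unfold Gfun
    rw [ofReal_mul, ofReal_cpow Real.pi_pos.le, ← Gamma_ofReal]
    push_cast; rfl
  rw [e, norm_real, Real.norm_of_nonneg]
  have : 0 < Real.Gamma (x / 2 + 1) := Real.Gamma_pos_of_pos (by linarith)
  have := Real.pi_pos
  positivity

lemma Gfun_real_ratio {x y : ℝ} (hx : 2 ≤ x) (hxy : x ≤ y) :
    ‖Gfun x‖ ≤ Real.pi ^ ((y - x) / 2) * ‖Gfun y‖ := by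
  rw [Gfun_real_norm x (by linarith), Gfun_real_norm y (by linarith), ← mul_assoc,
    ← Real.rpow_add Real.pi_pos]
  have e : (y - x) / 2 + -y / 2 = -x / 2 := by ring
  rw [e]
  have := Real.Gamma_strictMonoOn_Ici.monotoneOn (a := x / 2 + 1) (b := y / 2 + 1)
    (by simp; linarith) (by simp; linarith) (by linarith)
  have := Real.pi_pos
  gcongr

lemma XI_mono_aux (RH : RiemannHypothesis) {h : ℝ} (hh : 0 < h) (hh4 : h ≤ 1 / 4) {z : ℂ}
    (hz : 0 ≤ z.re) : ‖XI ((1 / 2 - h : ℝ) + z)‖ ≤ ‖XI ((1 / 2 + h : ℝ) + z)‖ := by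
  have hne : ∀ w : ℂ, 0 ≤ w.re → XI ((1 / 2 + h : ℝ) + w) ≠ 0 := fun w hw =>
    XI_ne_zero RH (by rw [add_re, ofReal_re]; linarith)
  set Q : ℂ → ℂ := fun w => XI ((1 / 2 - h : ℝ) + w) / XI ((1 / 2 + h : ℝ) + w) with hQ
  suffices H : ‖Q z‖ ≤ 1 by
    rw [hQ] at H
    simp only [norm_div] at H
    rwa [div_le_one (norm_pos_iff.2 (hne z hz))] at H
  obtain ⟨C2, hC2, h2⟩ := XI_upper
  obtain ⟨C3, hC3, h3⟩ := XI_lower RH hh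
  obtain ⟨Z, hZ, hz2⟩ := zeta_bound
  refine PhragmenLindelof.right_half_plane_of_bounded_on_real (f := Q) (C := 1) ?_ ?_ ?_ ?_ hz
  · refine DifferentiableOn.diffContOnCl ?_
    rw [closure_setOf_lt_re]
    refine DifferentiableOn.div ?_ ?_ (fun w hw => hne w hw)
    · exact (XI_differentiable.comp (differentiable_id.const_add _)).differentiableOn
    · exact (XI_differentiable.comp (differentiable_id.const_add _)).differentiableOn
  · refine ⟨3 / 2, by norm_num, (C2 + C3) * 2 ^ (3 / 2 : ℝ), ?_⟩
    refine Asymptotics.IsBigO.of_bound 1 ?_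
    rw [eventually_inf_principal]
    filter_upwards [(tendsto_norm_cobounded_atTop (E := ℂ)).eventually_ge_atTop 2] with w hw hwre
    have hwre' : 0 < w.re := hwre
    rw [one_mul, Real.norm_of_nonneg (Real.exp_pos _).le]
    have hb : ∀ r : ℝ, |r| ≤ 1 → (1 + ‖(r : ℂ) + w‖) ^ (3 / 2 : ℝ) ≤
        2 ^ (3 / 2 : ℝ) * ‖w‖ ^ (3 / 2 : ℝ) := by
      intro r hr
      rw [← Real.mul_rpow (by norm_num) (norm_nonneg _)]
      apply Real.rpow_le_rpow (by positivity) _ (by norm_num)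
      have := norm_add_le (r : ℂ) w
      rw [norm_real, Real.norm_eq_abs] at this
      linarith
    have hu := h2 ((1 / 2 - h : ℝ) + w) (by rw [add_re, ofReal_re]; linarith)
    have hl := h3 ((1 / 2 + h : ℝ) + w) (by rw [add_re, ofReal_re]; linarith)
    have b1 := hb (1 / 2 - h) (by rw [abs_le]; constructor <;> linarith)
    have b2 := hb (1 / 2 + h) (by rw [abs_le]; constructor <;> linarith)
    rw [hQ]
    simp only [norm_div]
    rw [div_le_iff₀ (norm_pos_iff.2 (hne w hwre'.le))]
    set W := 2 ^ (3 / 2 : ℝ) * ‖w‖ ^ (3 / 2 : ℝ)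
    calc ‖XI ((1 / 2 - h : ℝ) + w)‖ ≤ Real.exp (C2 * W) := hu.trans (Real.exp_le_exp.2 (by gcongr))
      _ = Real.exp ((C2 + C3) * W) * Real.exp (-(C3 * W)) := by
        rw [← Real.exp_add]; congr 1; ring
      _ ≤ Real.exp ((C2 + C3) * W) * ‖XI ((1 / 2 + h : ℝ) + w)‖ := by
        gcongr
        exact le_trans (Real.exp_le_exp.2 (neg_le_neg (by gcongr))) hl
      _ = _ := by rw [mul_assoc (C2 + C3)]
  · refine isBoundedUnder_of_eventually_le (a := Real.pi ^ h * Z * Z) ?_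
    filter_upwards [eventually_ge_atTop 3] with x hx
    rw [hQ]
    simp only [norm_div]
    rw [div_le_iff₀ (norm_pos_iff.2 (hne x (by rw [ofReal_re]; linarith)))]
    rw [← ofReal_add, ← ofReal_add]
    have key : ∀ y : ℝ, 2 ≤ y → ‖XI y‖ = 2 * (y - 1) * ‖Gfun y‖ * ‖riemannZeta y‖ := by
      intro y hy
      rw [XI_eq (by rw [ofReal_re]; linarith) (by
        intro hh1; have : y = 1 := by exact_mod_cast hh1
        linarith)]
      rw [norm_mul, norm_mul, norm_mul, norm_ofNat, ← ofReal_one, ← ofReal_sub, norm_real,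
        Real.norm_of_nonneg (by linarith)]
    rw [key _ (by linarith), key _ (by linarith)]
    have hr := Gfun_real_ratio (x := 1 / 2 - h + x) (y := 1 / 2 + h + x) (by linarith) (by linarith)
    have e : (1 / 2 + h + x - (1 / 2 - h + x)) / 2 = h := by ring
    rw [e] at hr
    have z1 := (hz2 ((1 / 2 - h + x : ℝ) : ℂ) (by rw [ofReal_re]; linarith)).1
    have z2 := (hz2 ((1 / 2 + h + x : ℝ) : ℂ) (by rw [ofReal_re]; linarith)).2
    have z3 : Z ≤ Z * Z * ‖riemannZeta ((1 / 2 + h + x : ℝ) : ℂ)‖ := by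
      calc Z = Z * Z * Z⁻¹ := by field_simp
        _ ≤ _ := by gcongr
    have hpi := Real.pi_pos
    calc 2 * (1 / 2 - h + x - 1) * ‖Gfun ((1 / 2 - h + x : ℝ) : ℂ)‖ *
          ‖riemannZeta ((1 / 2 - h + x : ℝ) : ℂ)‖
        ≤ 2 * (1 / 2 + h + x - 1) * (Real.pi ^ h * ‖Gfun ((1 / 2 + h + x : ℝ) : ℂ)‖) *
          (Z * Z * ‖riemannZeta ((1 / 2 + h + x : ℝ) : ℂ)‖) := by
          have : 0 ≤ 1 / 2 + h + x - 1 := by linarith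
          refine mul_le_mul (mul_le_mul (by linarith) hr (norm_nonneg _) (by positivity))
            (z1.trans z3) (norm_nonneg _) (by positivity)
      _ = _ := by ring
  · intro v
    rw [hQ]
    simp only [norm_div]
    refine div_le_one_of_le₀ (le_of_eq ?_) (norm_nonneg _)
    have e : ((1 / 2 - h : ℝ) + v * I : ℂ) =
        1 - (starRingEnd ℂ) ((1 / 2 + h : ℝ) + v * I) := by
      simp only [map_add, map_mul, conj_ofReal, conj_I]; push_cast; ring
    rw [e, XI_one_sub, XI_conj (by simp; linarith) (by
      intro h1; have := congrArg re h1; simp at this; linarith), RCLike.norm_conj]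

/-- Logarithmic derivative of XI at the shifted point. -/
noncomputable def G (z : ℂ) : ℂ := logDeriv XI (1 / 2 + z)

theorem G_re_nonneg (RH : RiemannHypothesis) {z : ℂ} (hz : 0 < z.re) : 0 ≤ (G z).re := by
  set p : ℂ := 1 / 2 + z with hp
  have hpre : 1 / 2 < p.re := by rw [hp, add_re]; norm_num; exact hz
  have hX : XI p ≠ 0 := XI_ne_zero RH hpre
  have hd : HasDerivAt XI (deriv XI p) p := XI_differentiable.differentiableAt.hasDerivAt
  -- real path
  have hpath : HasDerivAt (fun u : ℝ => XI (p + u)) (deriv XI p) 0 := by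
    have h0 : HasDerivAt XI (deriv XI p) (p + ((0 : ℝ) : ℂ)) := by simpa using hd
    have := h0.scomp (0 : ℝ) ((ofRealCLM.hasDerivAt (x := (0 : ℝ))).const_add p)
    simpa [Function.comp_def] using this
  have hq : HasDerivAt (fun u : ℝ => XI (p + u) / XI p) (G z) 0 := by
    have := hpath.div_const (XI p)
    rwa [G, logDeriv_apply]
  have hq0 : XI (p + ((0 : ℝ) : ℂ)) / XI p = 1 := by simp [hX]
  -- squared norm
  have hre : HasDerivAt (fun u : ℝ => (XI (p + u) / XI p).re) (G z).re 0 :=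
    (reCLM.hasFDerivAt.comp_hasDerivAt (0 : ℝ) hq)
  have him : HasDerivAt (fun u : ℝ => (XI (p + u) / XI p).im) (G z).im 0 :=
    (imCLM.hasFDerivAt.comp_hasDerivAt (0 : ℝ) hq)
  have hN : HasDerivAt (fun u : ℝ => (XI (p + u) / XI p).re * (XI (p + u) / XI p).re +
      (XI (p + u) / XI p).im * (XI (p + u) / XI p).im) (2 * (G z).re) 0 := by
    convert! (hre.mul hre).add (him.mul him) using 1
    rw [hq0]; simp; ring
  set N : ℝ → ℝ := fun u => (XI (p + u) / XI p).re * (XI (p + u) / XI p).re +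
      (XI (p + u) / XI p).im * (XI (p + u) / XI p).im with hNdef
  have hN2 : HasDerivAt (fun u : ℝ => N u - N (-u)) (2 * (2 * (G z).re)) 0 := by
    have h1 : HasDerivAt (fun u : ℝ => N (-u)) (-(2 * (G z).re)) 0 := by
      have h0 : HasDerivAt N (2 * (G z).re) (-0) := by simpa using hN
      simpa [Function.comp_def] using h0.comp (0 : ℝ) (hasDerivAt_neg (0 : ℝ))
    convert! hN.sub h1 using 1
    ring
  have hmono : ∀ u : ℝ, 0 < u → u ≤ 1 / 4 → 0 ≤ N u - N (-u) := by
    intro u hu hu4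
    have h := XI_mono_aux RH hu hu4 (z := z) hz.le
    have e1 : ((1 / 2 - u : ℝ) + z : ℂ) = p + ((-u : ℝ) : ℂ) := by rw [hp]; push_cast; ring
    have e2 : ((1 / 2 + u : ℝ) + z : ℂ) = p + (u : ℂ) := by rw [hp]; push_cast; ring
    rw [e1, e2] at h
    have hNn : ∀ x : ℝ, N x = ‖XI (p + x) / XI p‖ ^ 2 := by
      intro x; rw [Complex.sq_norm, normSq_apply]
    rw [hNn, hNn, norm_div, norm_div, sub_nonneg]
    gcongr
  have hslope := hN2.tendsto_slope_zero_right
  have : 0 ≤ 2 * (2 * (G z).re) := by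
    refine ge_of_tendsto hslope ?_
    filter_upwards [Ioc_mem_nhdsGT (show (0 : ℝ) < 1 / 4 by norm_num)] with u hu
    have := hmono u hu.1 hu.2
    have hu1 := hu.1
    simp only [zero_add, neg_zero, sub_self, sub_zero, smul_eq_mul]
    positivity
  linarith

end PMZ


namespace PMZ
open Filter Topology Set

lemma logDeriv_XI_eq (RH : RiemannHypothesis) {s : ℂ} (hs : 1 / 2 < s.re) (h1 : s ≠ 1) :
    logDeriv XI s = deriv riemannZeta s / riemannZeta s + 1 / (s - 1) + Psi s := by
  have hX := XI_ne_zero RH hs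
  have heq : XI s = 2 * (s - 1) * Gfun s * riemannZeta s := XI_eq (by linarith) h1
  have hz : riemannZeta s ≠ 0 := by
    intro h; apply hX; rw [heq, h, mul_zero]
  have hs1 : s - 1 ≠ 0 := sub_ne_zero.2 h1
  have hG := Gfun_ne_zero (s := s) (by linarith)
  have hev : XI =ᶠ[𝓝 s] fun s => 2 * (s - 1) * Gfun s * riemannZeta s := by
    filter_upwards [(isOpen_lt continuous_const continuous_re).mem_nhds hs,
      isOpen_ne.mem_nhds h1] with w hw hw1
    have : 1 / 2 < w.re := hw
    exact XI_eq (by linarith) hw1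
  have hd : HasDerivAt (fun s => 2 * (s - 1) * Gfun s * riemannZeta s)
      ((2 * 1 * Gfun s + 2 * (s - 1) * (Gfun s * Psi s)) * riemannZeta s +
        2 * (s - 1) * Gfun s * deriv riemannZeta s) s :=
    ((((hasDerivAt_id s).sub_const 1).const_mul 2).mul (Gfun_hasDerivAt (by linarith))).mul
      (differentiableAt_riemannZeta h1).hasDerivAt
  rw [logDeriv_apply, hev.deriv_eq, hd.deriv, heq]
  field_simp
  ring

lemma G_eq (RH : RiemannHypothesis) {s : ℂ} (hs : 1 / 2 < s.re) (h1 : s ≠ 1) :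
    G (s - 1 / 2) = deriv riemannZeta s / riemannZeta s + 1 / (s - 1) + Psi s := by
  rw [← logDeriv_XI_eq RH hs h1, G]; congr 1; ring

lemma G_half : G (1 / 2) = -((Real.log (4 * Real.pi) / 2 - 1 -
    Real.eulerMascheroniConstant / 2 : ℝ) : ℂ) := by
  have e : (1 / 2 + 1 / 2 : ℂ) = 1 := by norm_num
  rw [G, e, logDeriv_apply, XI_one]
  have hd : HasDerivAt XI ((1 * (1 - 1) + 1 * 1) * completedRiemannZeta₀ 1 +
      1 * (1 - 1) * deriv completedRiemannZeta₀ 1) 1 :=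
    (((hasDerivAt_id (1 : ℂ)).mul ((hasDerivAt_id (1 : ℂ)).sub_const 1)).mul
      (differentiable_completedZeta₀ 1).hasDerivAt).add_const 1
  rw [hd.deriv, completedRiemannZeta₀_one]
  have : ((Real.log (4 * Real.pi) : ℝ) : ℂ) = log (4 * (Real.pi : ℂ)) := by
    rw [ofReal_log (by positivity)]; push_cast; rfl
  push_cast
  rw [this]; ring

lemma G_differentiableOn (RH : RiemannHypothesis) : DifferentiableOn ℂ G {z | 0 < z.re} := by
  have h : DifferentiableOn ℂ (logDeriv XI) {s | 1 / 2 < s.re} := by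
    have ho : IsOpen {s : ℂ | 1 / 2 < s.re} := isOpen_lt continuous_const continuous_re
    exact (XI_differentiable.differentiableOn.deriv ho).div XI_differentiable.differentiableOn
      (fun s hs => XI_ne_zero RH hs)
  refine h.comp ((differentiable_id.const_add _).differentiableOn) ?_
  intro z hz
  have hz' : 0 < z.re := hz
  simp; exact hz'

lemma vM_bound : ∃ C : ℝ, 0 ≤ C ∧ ∀ s : ℂ, 3 / 2 ≤ s.re →
    ‖deriv riemannZeta s / riemannZeta s‖ ≤ C := by
  obtain ⟨C, hC, hb⟩ := Lser_bound (fun n => ((ArithmeticFunction.vonMangoldt n : ℝ) : ℂ))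
    (σ := 3 / 2) (ArithmeticFunction.LSeriesSummable_vonMangoldt (by norm_num))
  refine ⟨C, hC, fun s hs => ?_⟩
  have := hb s hs
  rw [ArithmeticFunction.LSeries_vonMangoldt_eq_deriv_riemannZeta_div (by linarith)] at this
  rwa [neg_div, norm_neg] at this

lemma G_growth_right (RH : RiemannHypothesis) : ∃ C : ℝ, 0 ≤ C ∧ ∀ z : ℂ, 1 ≤ z.re →
    ‖G z‖ ≤ C * Real.sqrt (1 + ‖z‖) := by
  obtain ⟨C1, hC1, h1⟩ := vM_bound
  obtain ⟨C2, hC2, h2⟩ := Psi_bound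
  refine ⟨C1 + 2 + C2 * 2, by positivity, fun z hz => ?_⟩
  have hre : (z + 1 / 2).re = z.re + 1 / 2 := by rw [add_re]; norm_num
  have hne : z + 1 / 2 ≠ 1 := by
    intro h; have := congrArg re h; rw [hre, one_re] at this; linarith
  have e := G_eq RH (s := z + 1 / 2) (by rw [hre]; linarith) hne
  rw [add_sub_cancel_right] at e
  rw [e]
  have b1 := h1 (z + 1 / 2) (by rw [hre]; linarith)
  have b2 := h2 (z + 1 / 2) (by rw [hre]; linarith)
  have hn := norm_nonneg z
  have b3 : ‖1 / (z + 1 / 2 - 1)‖ ≤ 2 := by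
    rw [norm_div, norm_one, div_le_iff₀ (norm_pos_iff.2 (sub_ne_zero.2 hne))]
    have : 1 / 2 ≤ ‖z + 1 / 2 - 1‖ := by
      refine le_trans ?_ (re_le_norm _)
      rw [sub_re, hre, one_re]; linarith
    linarith
  have hs1 : 1 ≤ Real.sqrt (1 + ‖z‖) := Real.one_le_sqrt.2 (by linarith)
  have b4 : Real.sqrt (1 + ‖z + 1 / 2‖) ≤ 2 * Real.sqrt (1 + ‖z‖) := by
    rw [show (2 : ℝ) * Real.sqrt (1 + ‖z‖) = Real.sqrt (4 * (1 + ‖z‖)) by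
      rw [Real.sqrt_mul (by norm_num), show (4 : ℝ) = 2 ^ 2 by norm_num,
        Real.sqrt_sq (by norm_num)]]
    apply Real.sqrt_le_sqrt
    have := norm_add_le z (1 / 2)
    norm_num at this ⊢
    linarith
  calc _ ≤ ‖deriv riemannZeta (z + 1 / 2) / riemannZeta (z + 1 / 2)‖ + ‖1 / (z + 1 / 2 - 1)‖
        + ‖Psi (z + 1 / 2)‖ := norm_add₃_le
    _ ≤ C1 + 2 + C2 * (2 * Real.sqrt (1 + ‖z‖)) := by
      gcongr; exact b2.trans (by gcongr)
    _ ≤ _ := by nlinarith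

lemma G_growth (RH : RiemannHypothesis) {δ : ℝ} (hδ : 0 < δ) (hδ1 : δ ≤ 1) :
    ∃ C : ℝ, 0 ≤ C ∧ ∀ z : ℂ, δ ≤ z.re → ‖G z‖ ≤ C * Real.sqrt (1 + ‖z‖) := by
  obtain ⟨C, hC, h⟩ := G_growth_right RH
  refine ⟨2 / δ + 2 * (2 * C) / δ, by positivity, fun z hz => ?_⟩
  have hn := norm_nonneg z
  have hs1 : 1 ≤ Real.sqrt (1 + ‖z‖) := Real.one_le_sqrt.2 (by linarith)
  rcases le_total 1 z.re with h1 | h1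
  · refine (h z h1).trans ?_
    gcongr
    have : C ≤ 2 * (2 * C) / δ := by
      rw [le_div_iff₀ hδ]; nlinarith
    have : 0 ≤ 2 / δ := by positivity
    linarith
  set c : ℂ := ⟨1, z.im⟩ with hc
  have hmem : ∀ u : ℂ, u ∈ Metric.ball (0 : ℂ) 1 → 0 < (c + u).re := by
    intro u hu
    have hu' : ‖u‖ < 1 := by simpa using hu
    have := (abs_lt.1 ((abs_re_le_norm u).trans_lt hu')).1
    rw [add_re]; simp only [hc]; linarith
  have hd : DifferentiableOn ℂ (fun u => -G (c + u)) (Metric.ball 0 1) :=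
    ((G_differentiableOn RH).comp ((differentiable_id.const_add c).differentiableOn)
      (fun u hu => hmem u hu)).neg
  have hzc : ‖z - c‖ ≤ 1 - δ := by
    have : z - c = ((z.re - 1 : ℝ) : ℂ) := by apply Complex.ext <;> simp [hc]
    rw [this, norm_real, Real.norm_eq_abs, abs_le]
    constructor <;> linarith
  have hBC := borelCaratheodory (M := 1) (f := fun u => -G (c + u)) (R := 1) (z := z - c) one_pos hd
    (fun u hu => by
      have := G_re_nonneg RH (hmem u hu)
      change (-G (c + u)).re ≤ 1
      rw [neg_re]; linarith) one_pos (by rw [mem_ball_zero_iff]; linarith)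
  simp only [add_sub_cancel, add_zero, norm_neg] at hBC
  have hcn : ‖c‖ ≤ 1 + ‖z‖ := by
    refine (norm_le_abs_re_add_abs_im c).trans ?_
    have := abs_im_le_norm z
    simp [hc]; linarith
  have hGc : ‖G c‖ ≤ 2 * C * Real.sqrt (1 + ‖z‖) := by
    refine (h c (by simp [hc])).trans ?_
    rw [mul_comm 2 C, mul_assoc]
    gcongr
    rw [show (2 : ℝ) * Real.sqrt (1 + ‖z‖) = Real.sqrt (4 * (1 + ‖z‖)) by
      rw [Real.sqrt_mul (by norm_num), show (4 : ℝ) = 2 ^ 2 by norm_num,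
        Real.sqrt_sq (by norm_num)]]
    apply Real.sqrt_le_sqrt
    linarith
  have hd1 : δ ≤ 1 - ‖z - c‖ := by linarith
  have hzc1 : ‖z - c‖ ≤ 1 := by linarith
  calc ‖G z‖ ≤ 2 * 1 * ‖z - c‖ / (1 - ‖z - c‖) + ‖G c‖ * (1 + ‖z - c‖) / (1 - ‖z - c‖) := hBC
    _ ≤ 2 * 1 * 1 / δ + (2 * C * Real.sqrt (1 + ‖z‖)) * (1 + 1) / δ := by gcongr
    _ = 2 / δ * 1 + 2 * (2 * C) / δ * Real.sqrt (1 + ‖z‖) := by ring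
    _ ≤ 2 / δ * Real.sqrt (1 + ‖z‖) + 2 * (2 * C) / δ * Real.sqrt (1 + ‖z‖) := by gcongr
    _ = _ := by ring

end PMZ


namespace PMZ
open Filter Topology Set MeasureTheory
open scoped FourierTransform

lemma inv_lemma {k H : ℝ → ℂ} (hk : Continuous k) (hki : Integrable k) (hH : Integrable H)
    (hkH : ∀ v : ℝ, ∫ u : ℝ, exp (-(u * v) * I) * k u = H v) (u : ℝ) :
    (1 / (2 * Real.pi) : ℂ) * ∫ v : ℝ, exp (u * v * I) * H v = k u := by
  have hF : 𝓕 k = fun ξ : ℝ => H (2 * Real.pi * ξ) := by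
    funext ξ
    rw [Real.fourier_real_eq_integral_exp_smul, ← hkH]
    congr 1; funext w
    rw [smul_eq_mul]; congr 2; push_cast; ring
  have hHi : Integrable (𝓕 k) := by
    rw [hF]; exact hH.comp_mul_left' (by positivity)
  have := hki.fourierInv_fourier_eq hHi (v := u) hk.continuousAt
  rw [Real.fourierInv_eq', hF] at this
  rw [← this]
  have e := Measure.integral_comp_mul_left (fun v : ℝ => exp (u * v * I) * H v) (2 * Real.pi)
  rw [abs_of_pos (by positivity)] at e
  have e2 : (∫ x : ℝ, exp (↑(2 * Real.pi * inner ℝ x u) * I) • H (2 * Real.pi * x)) =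
      ∫ x : ℝ, (fun v : ℝ => exp (u * v * I) * H v) (2 * Real.pi * x) := by
    congr 1; funext x
    simp only [smul_eq_mul]
    congr 2
    simp [inner]
    ring
  rw [e2, e, real_smul]
  push_cast; rw [one_div]

lemma integrable_aux {A : ℂ} (hA : 0 < A.re) : Integrable (fun v : ℝ => (‖A + v * I‖ ^ 2)⁻¹) := by
  have h0 : Integrable (fun x : ℝ => (1 + (x + A.im) ^ 2)⁻¹) :=
    integrable_inv_one_add_sq.comp_add_right A.im
  have hm : 0 < min 1 (A.re ^ 2) := by positivity
  have h1 : Continuous (fun v : ℝ => ‖A + v * I‖ ^ 2) := by fun_prop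
  have hn : ∀ v : ℝ, ‖A + v * I‖ ^ 2 = A.re ^ 2 + (v + A.im) ^ 2 := by
    intro v; rw [Complex.sq_norm, normSq_apply]; simp; ring
  refine (h0.const_mul (min 1 (A.re ^ 2))⁻¹).mono'
    (h1.inv₀ (fun v => by rw [hn]; positivity)).aestronglyMeasurable (ae_of_all _ fun v => ?_)
  rw [Real.norm_of_nonneg (by positivity), ← mul_inv, hn]
  apply inv_anti₀ (by positivity)
  have h2 : min 1 (A.re ^ 2) ≤ 1 := min_le_left _ _
  have h3 : min 1 (A.re ^ 2) ≤ A.re ^ 2 := min_le_right _ _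
  nlinarith [sq_nonneg (v + A.im)]

lemma A_ne {A : ℂ} (hA : 0 < A.re) (v : ℝ) : A + v * I ≠ 0 := by
  intro h; have := congrArg re h; simp at this; linarith

lemma integrable_H {A B : ℂ} (hA : 0 < A.re) (hB : 0 < B.re) :
    Integrable (fun v : ℝ => 1 / ((A + v * I) * (B + v * I))) := by
  have hc : Continuous (fun v : ℝ => 1 / ((A + v * I) * (B + v * I))) := by
    refine continuous_const.div (by fun_prop) (fun v => mul_ne_zero (A_ne hA v) (A_ne hB v))
  refine ((integrable_aux hA).add (integrable_aux hB)).mono' hc.aestronglyMeasurable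
    (ae_of_all _ fun v => ?_)
  rw [norm_div, norm_one, norm_mul, one_div, mul_inv]
  simp only [Pi.add_apply]
  rw [← inv_pow, ← inv_pow]
  nlinarith [sq_nonneg (‖A + v * I‖⁻¹ - ‖B + v * I‖⁻¹), sq_nonneg (‖A + v * I‖⁻¹),
    sq_nonneg (‖B + v * I‖⁻¹)]

lemma exp_Ioi {A : ℂ} (hA : 0 < A.re) :
    IntegrableOn (fun u : ℝ => exp (-A * u)) (Ioi 0) ∧ ∫ u in Ioi (0 : ℝ), exp (-A * u) = 1 / A := by
  have hA' : (-A).re < 0 := by rw [neg_re]; linarith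
  refine ⟨integrableOn_exp_mul_complex_Ioi hA' 0, ?_⟩
  rw [integral_exp_mul_complex_Ioi hA' 0]
  simp

/-- generic one-sided inversion -/
lemma inv_onesided {f : ℝ → ℂ} {H : ℝ → ℂ} (hf : Continuous f) (hf0 : f 0 = 0)
    (hfi : IntegrableOn f (Ioi 0)) (hH : Integrable H)
    (hfH : ∀ v : ℝ, ∫ u in Ioi (0 : ℝ), exp (-(u * v) * I) * f u = H v) (u : ℝ) :
    (1 / (2 * Real.pi) : ℂ) * ∫ v : ℝ, exp (u * v * I) * H v = if 0 ≤ u then f u else 0 := by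
  have hk : Continuous (fun u : ℝ => if 0 ≤ u then f u else 0) := by
    refine Continuous.if_le hf continuous_const continuous_const continuous_id ?_
    intro x hx; rw [← hx, hf0]
  have hind : (fun u : ℝ => if 0 ≤ u then f u else 0) = (Ioi (0 : ℝ)).indicator f := by
    funext x
    by_cases hx : 0 < x
    · simp [indicator, hx, hx.le]
    · rcases eq_or_ne x 0 with rfl | h0
      · simp [hf0]
      · have : ¬ 0 ≤ x := fun h => hx (lt_of_le_of_ne h h0.symm)
        simp [indicator, hx, this]
  refine inv_lemma (k := fun u : ℝ => if 0 ≤ u then f u else 0) hk ?_ hH ?_ u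
  · rw [hind]; exact hfi.integrable_indicator measurableSet_Ioi
  · intro v
    rw [← hfH v, ← integral_indicator measurableSet_Ioi]
    congr 1; funext x
    have := congrFun hind x
    rw [this]
    by_cases hx : x ∈ Ioi (0 : ℝ)
    · simp only [indicator_of_mem hx]
    · simp only [indicator_of_notMem hx, mul_zero]

lemma ker_exp {A B : ℂ} (hA : 0 < A.re) (hB : 0 < B.re) (hAB : A ≠ B) (u : ℝ) :
    (1 / (2 * Real.pi) : ℂ) * ∫ v : ℝ, exp (u * v * I) * (1 / ((A + v * I) * (B + v * I))) =
      if 0 ≤ u then (exp (-A * u) - exp (-B * u)) / (B - A) else 0 := by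
  have hBA : B - A ≠ 0 := sub_ne_zero.2 hAB.symm
  refine inv_onesided (f := fun u : ℝ => (exp (-A * u) - exp (-B * u)) / (B - A))
    (by fun_prop) (by simp) (((exp_Ioi hA).1.sub (exp_Ioi hB).1).div_const _)
    (integrable_H hA hB) ?_ u
  intro v
  have hA' : 0 < (A + v * I).re := by simpa using hA
  have hB' : 0 < (B + v * I).re := by simpa using hB
  have e : ∀ u : ℝ, exp (-(u * v) * I) * ((exp (-A * u) - exp (-B * u)) / (B - A)) =
      (exp (-(A + v * I) * u) - exp (-(B + v * I) * u)) / (B - A) := by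
    intro u
    rw [mul_div_assoc', mul_sub, ← exp_add, ← exp_add]
    congr 3 <;> ring_nf
  simp_rw [e]
  rw [integral_div, integral_sub (exp_Ioi hA').1 (exp_Ioi hB').1, (exp_Ioi hA').2, (exp_Ioi hB').2]
  have h1 := A_ne hA v
  have h2 := A_ne hB v
  field_simp
  ring

lemma ker_exp_double (u : ℝ) :
    (1 / (2 * Real.pi) : ℂ) * ∫ v : ℝ, exp (u * v * I) * (1 / ((1 + v * I) * (1 + v * I))) =
      if 0 ≤ u then u * exp (-u) else 0 := by
  have hint : IntegrableOn (fun u : ℝ => (u : ℂ) * exp (-u)) (Ioi 0) := by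
    have h := Real.GammaIntegral_convergent (s := 2) two_pos
    have h2 := h.ofReal (𝕜 := ℂ)
    refine h2.congr ?_
    filter_upwards [ae_restrict_mem measurableSet_Ioi] with x hx
    norm_num
    ring
  refine inv_onesided (f := fun u : ℝ => (u : ℂ) * exp (-u))
    (by fun_prop) (by simp) hint (integrable_H (A := 1) (B := 1) (by simp) (by simp)) ?_ u
  intro v
  set p : ℂ := 1 + v * I with hp
  have hp0 : p ≠ 0 := A_ne (A := 1) (by simp) v
  have hpn : ∀ u : ℝ, ‖exp (-p * u)‖ = Real.exp (-u) := by
    intro u; rw [norm_exp]; simp [hp]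
  have hd : ∀ x ∈ Ici (0 : ℝ), HasDerivAt (fun u : ℝ => -((u : ℂ) / p + 1 / p ^ 2) * exp (-p * u))
      (exp (-(x * v) * I) * ((x : ℂ) * exp (-x))) x := by
    intro x _
    have h1 : HasDerivAt (fun z : ℂ => -(z / p + 1 / p ^ 2) * exp (-p * z))
        (-(1 / p) * exp (-p * x) + -((x : ℂ) / p + 1 / p ^ 2) * (exp (-p * x) * (-p * 1))) x :=
      (((hasDerivAt_id (x : ℂ)).div_const p).add_const _).neg.mul
        (((hasDerivAt_id (x : ℂ)).const_mul (-p)).cexp)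
    convert! h1.comp_ofReal using 1
    have e : exp (-(x * v) * I) * ((x : ℂ) * exp (-x)) = x * exp (-p * x) := by
      rw [mul_left_comm, ← exp_add]; congr 2; rw [hp]; ring
    rw [e]; field_simp; ring
  have hi : IntegrableOn (fun x : ℝ => exp (-(x * v) * I) * ((x : ℂ) * exp (-x))) (Ioi 0) := by
    have hm : AEStronglyMeasurable (fun x : ℝ => exp (-(x * v) * I) * ((x : ℂ) * exp (-x)))
        (volume.restrict (Ioi 0)) := by
      apply Continuous.aestronglyMeasurable; fun_prop
    refine hint.norm.mono' hm (ae_of_all _ fun x => ?_)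
    rw [norm_mul, norm_exp]; simp
  have ht : Tendsto (fun u : ℝ => -((u : ℂ) / p + 1 / p ^ 2) * exp (-p * u)) atTop (𝓝 0) := by
    rw [tendsto_zero_iff_norm_tendsto_zero]
    have b1 : Tendsto (fun u : ℝ => u ^ 1 * Real.exp (-u)) atTop (𝓝 0) :=
      Real.tendsto_pow_mul_exp_neg_atTop_nhds_zero 1
    have b0 : Tendsto (fun u : ℝ => Real.exp (-u)) atTop (𝓝 0) := Real.tendsto_exp_neg_atTop_nhds_zero
    have b2 : Tendsto (fun u : ℝ => (u ^ 1 * Real.exp (-u)) * ‖p‖⁻¹ + Real.exp (-u) * ‖1 / p ^ 2‖)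
        atTop (𝓝 0) := by
      have := (b1.mul_const ‖p‖⁻¹).add (b0.mul_const ‖1 / p ^ 2‖)
      rw [zero_mul, zero_mul, add_zero] at this; exact this
    refine squeeze_zero' (Eventually.of_forall fun u => norm_nonneg _) ?_ b2
    filter_upwards [eventually_ge_atTop 0] with u hu
    rw [norm_mul, norm_neg, hpn]
    have h3 := norm_add_le ((u : ℂ) / p) (1 / p ^ 2)
    rw [norm_div (u : ℂ) p, norm_real, Real.norm_of_nonneg hu] at h3
    calc _ ≤ (u / ‖p‖ + ‖1 / p ^ 2‖) * Real.exp (-u) := by gcongr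
      _ = _ := by rw [pow_one]; ring
  rw [integral_Ioi_of_hasDerivAt_of_tendsto' hd hi ht]
  simp
  ring

lemma ker_two_sided {a : ℝ} (ha : 0 < a) (u : ℝ) :
    (1 / (2 * Real.pi) : ℂ) * ∫ v : ℝ, exp (u * v * I) * (1 / (a ^ 2 + v ^ 2)) =
      exp (-a * |u|) / (2 * a) := by
  have ha' : (a : ℂ) ≠ 0 := by exact_mod_cast ha.ne'
  have hfac : ∀ v : ℝ, ((a : ℂ) + v * I) * (a - v * I) = a ^ 2 + v ^ 2 := by
    intro v; linear_combination (-(v : ℂ) ^ 2) * I_sq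
  have hne2 : ∀ v : ℝ, (a : ℂ) - v * I ≠ 0 := by
    intro v h; have := congrArg re h; simp at this; linarith
  have hne1 : ∀ v : ℝ, (a : ℂ) + v * I ≠ 0 := A_ne (by simpa using ha)
  have hH : Integrable (fun v : ℝ => (1 / (a ^ 2 + v ^ 2) : ℂ)) := by
    have := (integrable_aux (A := a) (by simpa using ha)).ofReal (𝕜 := ℂ)
    refine this.congr (ae_of_all _ fun v => ?_)
    simp only
    have : ‖(a : ℂ) + v * I‖ ^ 2 = a ^ 2 + v ^ 2 := by
      rw [Complex.sq_norm, normSq_apply]; simp; ring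
    rw [this]; simp
  have h1 : IntegrableOn (fun u : ℝ => exp (-a * |u|)) (Ioi 0) := by
    refine (exp_Ioi (A := a) (by simpa using ha)).1.congr_fun (fun x hx => ?_) measurableSet_Ioi
    have : (0 : ℝ) < x := hx
    simp only [abs_of_pos this]
  have h2 : IntegrableOn (fun u : ℝ => exp (-a * |u|)) (Iic 0) := by
    refine (integrableOn_exp_mul_complex_Iic (a := a) (by simpa using ha) 0).congr_fun
      (fun x hx => ?_) measurableSet_Iic
    have : x ≤ 0 := hx
    simp only [abs_of_nonpos this]; push_cast; ring_nf
  have hint : Integrable (fun u : ℝ => exp (-a * |u|)) := by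
    rw [← integrableOn_univ, ← Iic_union_Ioi (a := (0 : ℝ))]; exact h2.union h1
  refine inv_lemma (k := fun u : ℝ => exp (-a * |u|) / (2 * a)) (by fun_prop)
    (hint.div_const _) hH ?_ u
  intro v
  have hi : Integrable (fun u : ℝ => exp (-(u * v) * I) * (exp (-a * |u|) / (2 * a))) := by
    refine (hint.div_const (2 * (a : ℂ))).norm.mono' (by
      apply Continuous.aestronglyMeasurable; fun_prop) (ae_of_all _ fun x => ?_)
    rw [norm_mul, norm_exp]; simp
  rw [← intervalIntegral.integral_Iic_add_Ioi hi.integrableOn hi.integrableOn (b := 0)]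
  have hA : 0 < ((a : ℂ) + v * I).re := by simpa using ha
  have hB : 0 < ((a : ℂ) - v * I).re := by simpa using ha
  have e1 : ∫ u in Ioi (0 : ℝ), exp (-(u * v) * I) * (exp (-a * |u|) / (2 * a)) =
      (1 / (a + v * I)) / (2 * a) := by
    rw [← (exp_Ioi hA).2, ← integral_div]
    refine setIntegral_congr_fun measurableSet_Ioi fun x hx => ?_
    have : (0 : ℝ) < x := hx
    simp only [abs_of_pos this]
    rw [mul_div_assoc', ← exp_add]; congr 2; ring
  have e2 : ∫ u in Iic (0 : ℝ), exp (-(u * v) * I) * (exp (-a * |u|) / (2 * a)) =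
      (1 / (a - v * I)) / (2 * a) := by
    have h3 := integral_exp_mul_complex_Iic hB 0
    simp only [ofReal_zero, mul_zero, exp_zero] at h3
    rw [← h3, ← integral_div]
    refine setIntegral_congr_fun measurableSet_Iic fun x hx => ?_
    have : x ≤ 0 := hx
    simp only [abs_of_nonpos this]
    rw [mul_div_assoc', ← exp_add]; congr 2; push_cast; ring
  rw [e1, e2, ← hfac]
  have := hne1 v
  have := hne2 v
  field_simp
  ring

end PMZ


namespace PMZ
open Filter Topology Set MeasureTheory

lemma integrable_of_decay {g : ℝ → ℂ} (hg : Continuous g) {C : ℝ} (hC : 0 ≤ C)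
    (hb : ∀ v : ℝ, 1 ≤ |v| → ‖g v‖ ≤ C * (1 + |v|) ^ (-(3 / 2) : ℝ)) : Integrable g := by
  obtain ⟨M, hM⟩ := (isCompact_Icc (a := (-1 : ℝ)) (b := 1)).exists_bound_of_continuousOn
    hg.continuousOn
  have hM0 : 0 ≤ M := (norm_nonneg _).trans (hM 0 (by simp))
  have hI : Integrable (fun v : ℝ => (1 + ‖v‖) ^ (-(3 / 2) : ℝ)) :=
    integrable_one_add_norm (by simp; norm_num)
  refine (hI.const_mul (C + 4 * M)).mono' hg.aestronglyMeasurable (ae_of_all _ fun v => ?_)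
  rw [Real.norm_eq_abs]
  have hp : 0 ≤ (1 + |v|) ^ (-(3 / 2) : ℝ) := by positivity
  rcases le_total 1 |v| with h | h
  · refine (hb v h).trans ?_
    gcongr; linarith
  · have h1 : ‖g v‖ ≤ M := hM v (abs_le.1 h)
    have h2 : (1 / 4 : ℝ) ≤ (1 + |v|) ^ (-(3 / 2) : ℝ) := by
      calc (1 / 4 : ℝ) = (2 : ℝ) ^ (-2 : ℝ) := by
            rw [Real.rpow_neg (by norm_num)]; norm_num
        _ ≤ (2 : ℝ) ^ (-(3 / 2) : ℝ) := by
            apply Real.rpow_le_rpow_of_exponent_le <;> norm_num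
        _ ≤ _ := by
            apply Real.rpow_le_rpow_of_nonpos (by positivity) (by linarith) (by norm_num)
    nlinarith [mul_nonneg hC hp]

lemma shift {f : ℂ → ℂ} {α β C : ℝ} (hαβ : α ≤ β) (hC : 0 ≤ C)
    (hd : ∀ z : ℂ, α ≤ z.re → z.re ≤ β → DifferentiableAt ℂ f z)
    (hb : ∀ z : ℂ, α ≤ z.re → z.re ≤ β → 1 ≤ |z.im| →
      ‖f z‖ ≤ C * (1 + |z.im|) ^ (-(3 / 2) : ℝ)) :
    Integrable (fun v : ℝ => f (α + v * I)) ∧ Integrable (fun v : ℝ => f (β + v * I)) ∧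
    ∫ v : ℝ, f (α + v * I) = ∫ v : ℝ, f (β + v * I) := by
  have hc : ∀ x : ℝ, α ≤ x → x ≤ β → Integrable (fun v : ℝ => f (x + v * I)) := by
    intro x h1 h2
    refine integrable_of_decay ?_ hC (fun v hv => ?_)
    · rw [continuous_iff_continuousAt]
      intro v
      have h3 : ContinuousAt f (x + v * I) := (hd _ (by simpa using h1) (by simpa using h2)).continuousAt
      exact ContinuousAt.comp (f := fun v : ℝ => (x + v * I : ℂ)) h3 (by fun_prop)
    · have := hb (x + v * I) (by simpa using h1) (by simpa using h2) (by simpa using hv)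
      simpa using this
  have hα := hc α le_rfl hαβ
  have hβ := hc β hαβ le_rfl
  refine ⟨hα, hβ, ?_⟩
  have tα := intervalIntegral_tendsto_integral hα tendsto_neg_atTop_atBot tendsto_id
  have tβ := intervalIntegral_tendsto_integral hβ tendsto_neg_atTop_atBot tendsto_id
  have t3 : Tendsto (fun T : ℝ => (∫ x : ℝ in α..β, f (x + (-T : ℝ) * I)) -
      ∫ x : ℝ in α..β, f (x + T * I)) atTop (𝓝 0) := by
    have hz : Tendsto (fun T : ℝ => C * (1 + |T|) ^ (-(3 / 2) : ℝ) * |β - α|) atTop (𝓝 0) := by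
      have h1 : Tendsto (fun T : ℝ => (1 + |T|) ^ (-(3 / 2) : ℝ)) atTop (𝓝 0) :=
        (tendsto_rpow_neg_atTop (by norm_num)).comp
          (tendsto_atTop_add_const_left _ _ tendsto_abs_atTop_atTop)
      simpa using (h1.const_mul C).mul_const |β - α|
    have key : ∀ T : ℝ, 1 ≤ |T| → ‖∫ x : ℝ in α..β, f (x + T * I)‖ ≤
        C * (1 + |T|) ^ (-(3 / 2) : ℝ) * |β - α| := by
      intro T hT
      apply intervalIntegral.norm_integral_le_of_norm_le_const
      intro x hx
      rw [uIoc_of_le hαβ] at hx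
      have := hb (x + T * I) (by simpa using hx.1.le) (by simpa using hx.2) (by simpa using hT)
      simpa using this
    rw [← sub_zero (0 : ℂ)]
    refine Tendsto.sub ?_ ?_
    · refine squeeze_zero_norm' ?_ hz
      filter_upwards [eventually_ge_atTop 1] with T hT
      have := key (-T) (by rw [abs_neg]; exact hT.trans (le_abs_self T))
      rwa [abs_neg] at this
    · refine squeeze_zero_norm' ?_ hz
      filter_upwards [eventually_ge_atTop 1] with T hT
      exact key T (hT.trans (le_abs_self T))
  have hrect : ∀ T : ℝ, 0 ≤ T → (((∫ x : ℝ in α..β, f (x + (-T : ℝ) * I)) -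
      ∫ x : ℝ in α..β, f (x + T * I)) + I * ∫ y : ℝ in -T..T, f (β + y * I)) -
      I * ∫ y : ℝ in -T..T, f (α + y * I) = 0 := by
    intro T hT
    have := Complex.integral_boundary_rect_eq_zero_of_differentiableOn f (α + (-T : ℝ) * I)
      (β + T * I) (fun z hz => ?_)
    · simpa using this
    · rw [mem_reProdIm] at hz
      simp only [add_re, ofReal_re, mul_re, I_re, mul_zero, ofReal_im, I_im, mul_one, sub_self,
        add_zero, uIcc_of_le hαβ] at hz
      exact (hd z hz.1.1 hz.1.2).differentiableWithinAt
  have t4 := (t3.add (tβ.const_mul I)).sub (tα.const_mul I)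
  have t5 := t4.congr' (f₂ := fun _ => (0 : ℂ)) (by
    filter_upwards [eventually_ge_atTop 0] with T hT
    exact hrect T hT)
  have := tendsto_nhds_unique t5 tendsto_const_nhds
  have h6 : I * ((∫ v : ℝ, f (β + v * I)) - ∫ v : ℝ, f (α + v * I)) = 0 := by
    rw [← this]; ring
  rcases mul_eq_zero.1 h6 with h | h
  · exact absurd h I_ne_zero
  · exact (sub_eq_zero.1 h).symm

end PMZ


namespace PMZ
open Filter Topology Set MeasureTheory

/-- the function being shifted -/
noncomputable def hh (z0 : ℂ) (a u : ℝ) (w : ℂ) : ℂ :=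
  dslope (fun w => G (z0 + w)) 0 w * exp (u * w) / (w + 2 * a)

lemma hh_eq (z0 : ℂ) (a u : ℝ) {w : ℂ} (hw : w ≠ 0) :
    hh z0 a u w = (G (z0 + w) - G z0) * exp (u * w) / (w * (w + 2 * a)) := by
  unfold hh
  rw [dslope_of_ne _ hw, slope_def_field]
  simp only [sub_zero, add_zero]
  field_simp

lemma hh_shift (RH : RiemannHypothesis) {z0 : ℂ} (hz0 : z0.re = 1 / 2) {a : ℝ} (ha : 0 < a)
    (ha2 : a < 1 / 2) (u : ℝ) :
    Integrable (fun v : ℝ => hh z0 a u ((-a : ℝ) + v * I)) ∧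
    Integrable (fun v : ℝ => hh z0 a u ((1 : ℝ) + v * I)) ∧
    ∫ v : ℝ, hh z0 a u ((-a : ℝ) + v * I) = ∫ v : ℝ, hh z0 a u ((1 : ℝ) + v * I) := by
  obtain ⟨C, hC, hG⟩ := G_growth RH (δ := 1 / 2 - a) (by linarith) (by linarith)
  set S : ℝ := 2 + ‖z0‖ with hS
  have hS0 : 0 ≤ S := by positivity
  refine shift (C := 2 * C * Real.sqrt S * Real.exp |u| * 4) (by linarith) (by positivity) ?_ ?_
  · intro z h1 h2
    have hU : IsOpen {w : ℂ | -1 / 2 < w.re} := isOpen_lt continuous_const continuous_re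
    have hGd : DifferentiableOn ℂ (fun w => G (z0 + w)) {w : ℂ | -1 / 2 < w.re} := by
      refine (G_differentiableOn RH).comp (by fun_prop) (fun w hw => ?_)
      simp only [mem_setOf_eq, add_re] at hw ⊢
      rw [hz0]; linarith
    have h0 : {w : ℂ | -1 / 2 < w.re} ∈ 𝓝 (0 : ℂ) := hU.mem_nhds (by simp; norm_num)
    have hd := (Complex.differentiableOn_dslope h0).2 hGd
    have hzU : {w : ℂ | -1 / 2 < w.re} ∈ 𝓝 z := hU.mem_nhds (by simp only [mem_setOf_eq]; linarith)
    have hz := hd.differentiableAt hzU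
    unfold hh
    refine (hz.mul (by fun_prop)).div (by fun_prop) ?_
    intro h
    have := congrArg re h
    simp at this; linarith
  · intro z h1 h2 h3
    set v := z.im with hv
    have hz : z ≠ 0 := by
      rintro rfl; simp at hv; rw [hv] at h3; simp at h3; linarith
    rw [hh_eq _ _ _ hz]
    have n1 : (1 + |v|) / 2 ≤ ‖z‖ := by
      have := abs_im_le_norm z; rw [← hv] at this; linarith
    have n2 : (1 + |v|) / 2 ≤ ‖z + 2 * a‖ := by
      have := abs_im_le_norm (z + 2 * a); simp at this; rw [← hv] at this; linarith
    have nz : ‖z‖ ≤ 1 + |v| := by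
      refine (norm_le_abs_re_add_abs_im z).trans ?_
      have : |z.re| ≤ 1 := abs_le.2 ⟨by linarith, h2⟩
      linarith
    have g1 : ‖G (z0 + z)‖ ≤ C * (Real.sqrt S * Real.sqrt (1 + |v|)) := by
      refine (hG _ (by rw [add_re, hz0]; linarith)).trans ?_
      rw [← Real.sqrt_mul hS0]
      gcongr
      have := norm_add_le z0 z
      nlinarith [norm_nonneg z0, abs_nonneg v]
    have g2 : ‖G z0‖ ≤ C * (Real.sqrt S * Real.sqrt (1 + |v|)) := by
      refine (hG _ (by rw [hz0]; linarith)).trans ?_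
      rw [← Real.sqrt_mul hS0]
      gcongr
      nlinarith [norm_nonneg z0, abs_nonneg v]
    have e1 : ‖exp (u * z)‖ ≤ Real.exp |u| := by
      rw [norm_exp]
      apply Real.exp_le_exp.2
      simp only [mul_re, ofReal_re, ofReal_im, zero_mul, sub_zero]
      refine (le_abs_self _).trans ?_
      rw [abs_mul]
      have : |z.re| ≤ 1 := abs_le.2 ⟨by linarith, h2⟩
      nlinarith [abs_nonneg u]
    rw [norm_div, norm_mul, norm_mul]
    have hp : 0 < 1 + |v| := by positivity
    have hr : (1 + |v|) ^ (-(3 / 2) : ℝ) = Real.sqrt (1 + |v|) / (1 + |v|) ^ 2 := by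
      rw [Real.sqrt_eq_rpow, ← Real.rpow_natCast (1 + |v|) 2, ← Real.rpow_sub hp]; norm_num
    calc _ ≤ (2 * (C * (Real.sqrt S * Real.sqrt (1 + |v|))) * Real.exp |u|) /
          (((1 + |v|) / 2) * ((1 + |v|) / 2)) := by
          gcongr
          have := norm_sub_le (G (z0 + z)) (G z0)
          linarith
      _ = _ := by rw [hr]; field_simp; ring

noncomputable def JJ (z0 : ℂ) (a u : ℝ) : ℂ :=
  (1 / (2 * Real.pi) : ℂ) * ∫ v : ℝ, exp (u * v * I) * (G (z0 - a + v * I) / (a ^ 2 + v ^ 2))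
noncomputable def TT (z0 : ℂ) (a u : ℝ) : ℂ :=
  (1 / (2 * Real.pi) : ℂ) * ∫ v : ℝ, exp (u * v * I) *
    (G (z0 + 1 + v * I) * (1 / ((1 + v * I) * (1 + 2 * a + v * I))))

lemma sq_ne {a : ℝ} (ha : 0 < a) (v : ℝ) : (a ^ 2 + v ^ 2 : ℂ) ≠ 0 := by
  have : (0 : ℝ) < a ^ 2 + v ^ 2 := by positivity
  exact_mod_cast this.ne'

lemma integrable_sq {a : ℝ} (ha : 0 < a) : Integrable (fun v : ℝ => (1 / (a ^ 2 + v ^ 2) : ℂ)) := by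
  have := (integrable_aux (A := a) (by simpa using ha)).ofReal (𝕜 := ℂ)
  refine this.congr (ae_of_all _ fun v => ?_)
  simp only
  have : ‖(a : ℂ) + v * I‖ ^ 2 = a ^ 2 + v ^ 2 := by
    rw [Complex.sq_norm, normSq_apply]; simp; ring
  rw [this]; simp

lemma integrable_osc {g : ℝ → ℂ} (hg : Integrable g) (u : ℝ) :
    Integrable (fun v : ℝ => exp (u * v * I) * g v) := by
  refine hg.bdd_mul (c := 1) (by apply Continuous.aestronglyMeasurable; fun_prop)
    (ae_of_all _ fun v => ?_)
  rw [norm_exp]; simp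

lemma J_T_identity (RH : RiemannHypothesis) {z0 : ℂ} (hz0 : z0.re = 1 / 2) {a : ℝ} (ha : 0 < a)
    (ha2 : a < 1 / 2) (u : ℝ) :
    Integrable (fun v : ℝ => exp (u * v * I) * (G (z0 - a + v * I) / (a ^ 2 + v ^ 2))) ∧
    exp (-a * u) * (G z0 * (exp (-a * |u|) / (2 * a)) - JJ z0 a u) =
      exp u * (TT z0 a u - G z0 * (if 0 ≤ u then (exp (-1 * u) - exp (-(1 + 2 * a) * u)) / (1 + 2 * a - 1)
        else 0)) := by
  obtain ⟨i1, i2, h⟩ := hh_shift RH hz0 ha ha2 u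
  have haC : (a : ℂ) ≠ 0 := by exact_mod_cast ha.ne'
  have e1 : ∀ v : ℝ, hh z0 a u ((-a : ℝ) + v * I) = exp (-a * u) *
      (G z0 * (exp (u * v * I) * (1 / (a ^ 2 + v ^ 2))) -
        exp (u * v * I) * (G (z0 - a + v * I) / (a ^ 2 + v ^ 2))) := by
    intro v
    have hne : ((-a : ℝ) + v * I : ℂ) ≠ 0 := by
      intro h; have := congrArg re h; simp at this; linarith
    rw [hh_eq _ _ _ hne]
    have hq : ((-a : ℝ) + v * I : ℂ) * (((-a : ℝ) + v * I) + 2 * a) = -(a ^ 2 + v ^ 2) := by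
      push_cast; linear_combination (v : ℂ) ^ 2 * I_sq
    have hx : exp (u * ((-a : ℝ) + v * I)) = exp (-a * u) * exp (u * v * I) := by
      rw [← exp_add]; congr 1; push_cast; ring
    have hg : z0 + ((-a : ℝ) + v * I) = z0 - a + v * I := by push_cast; ring
    rw [hq, hx, hg]
    have := sq_ne ha v
    field_simp
    ring
  have e2 : ∀ v : ℝ, hh z0 a u ((1 : ℝ) + v * I) = exp u *
      (exp (u * v * I) * (G (z0 + 1 + v * I) * (1 / ((1 + v * I) * (1 + 2 * a + v * I)))) -
      G z0 * (exp (u * v * I) * (1 / ((1 + v * I) * (1 + 2 * a + v * I))))) := by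
    intro v
    have hne : ((1 : ℝ) + v * I : ℂ) ≠ 0 := by
      intro h; have := congrArg re h; simp at this
    rw [hh_eq _ _ _ hne]
    have hx : exp (u * ((1 : ℝ) + v * I)) = exp u * exp (u * v * I) := by
      rw [← exp_add]; congr 1; push_cast; ring
    have hg : z0 + ((1 : ℝ) + v * I) = z0 + 1 + v * I := by push_cast; ring
    have hq : ((1 : ℝ) + v * I + 2 * a : ℂ) = 1 + 2 * a + v * I := by push_cast; ring
    rw [hx, hg, hq, ofReal_one]
    ring
  simp_rw [e1] at i1 h
  simp_rw [e2] at i2 h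
  have k1 := integrable_osc (integrable_sq ha) u
  have k2 := integrable_osc (integrable_H (A := 1) (B := 1 + 2 * a) (by simp)
    (by simp; linarith)) u
  have j1 : Integrable (fun v : ℝ => exp (u * v * I) * (G (z0 - a + v * I) / (a ^ 2 + v ^ 2))) := by
    have := (k1.const_mul (G z0)).sub (i1.const_mul (exp (-a * u))⁻¹)
    refine this.congr (ae_of_all _ fun v => ?_)
    simp only [Pi.sub_apply]
    rw [inv_mul_cancel_left₀ (exp_ne_zero _)]; ring
  have j2 : Integrable (fun v : ℝ => exp (u * v * I) *
      (G (z0 + 1 + v * I) * (1 / ((1 + v * I) * (1 + 2 * a + v * I))))) := by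
    have := (k2.const_mul (G z0)).add (i2.const_mul (exp u)⁻¹)
    refine this.congr (ae_of_all _ fun v => ?_)
    simp only [Pi.add_apply]
    rw [inv_mul_cancel_left₀ (exp_ne_zero _)]; ring
  refine ⟨j1, ?_⟩
  rw [integral_const_mul, integral_const_mul, integral_sub (k1.const_mul _) j1,
    integral_sub j2 (k2.const_mul _), integral_const_mul, integral_const_mul] at h
  rw [← ker_exp (A := 1) (B := 1 + 2 * a) (by simp) (by simp; linarith) (by simpa using haC) u,
    ← ker_two_sided ha u]
  unfold JJ TT
  linear_combination (1 / (2 * Real.pi) : ℂ) * h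

lemma main_ineq (RH : RiemannHypothesis) {z0 : ℂ} (hz0 : z0.re = 1 / 2) {a : ℝ} (ha : 0 < a)
    (ha2 : a < 1 / 2) (hT : ∀ u : ℝ, u ≤ 0 → TT z0 a u = 0) {u : ℝ} (hu : 0 ≤ u) :
    ‖G z0 - 2 * a * (exp u * TT z0 a u) + exp (-(2 * a) * u) * (starRingEnd ℂ) (G z0)‖ ≤
      2 * Real.exp (-a * u) * (G z0).re := by
  have haC : (a : ℂ) ≠ 0 := by exact_mod_cast ha.ne'
  have hneg : ∀ u : ℝ, u ≤ 0 → JJ z0 a u = G z0 * (exp (a * u) / (2 * a)) := by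
    intro u hu
    have := (J_T_identity RH hz0 ha ha2 u).2
    rw [hT u hu] at this
    have h0 : (if 0 ≤ u then (exp (-1 * u) - exp (-(1 + 2 * a) * u)) / (1 + 2 * a - 1)
        else (0 : ℂ)) = 0 := by
      split_ifs with h
      · have : u = 0 := le_antisymm hu h
        simp [this]
      · rfl
    rw [h0, abs_of_nonpos hu] at this
    simp only [mul_zero, sub_zero, mul_eq_zero, exp_ne_zero, false_or] at this
    rw [← sub_eq_zero.1 this]
    congr 3; push_cast; ring
  have hpos : JJ z0 a u = exp (a * u) * (G z0 / (2 * a) - exp u * TT z0 a u) := by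
    have := (J_T_identity RH hz0 ha ha2 u).2
    rw [if_pos hu, abs_of_nonneg hu] at this
    have e1 : exp (-(1 + 2 * a) * u) = exp (-1 * u) * (exp (-a * u) * exp (-a * u)) := by
      rw [← exp_add, ← exp_add]; congr 1; ring
    have e2 : exp u * exp (-1 * u) = 1 := by rw [← exp_add]; simp
    have e3 : exp (a * u) * exp (-a * u) = 1 := by rw [← exp_add]; simp
    rw [e1] at this
    have h4 : G z0 * (exp (-a * u) / (2 * a)) - JJ z0 a u = exp (a * u) * (exp u * (TT z0 a u - G z0 * ((exp (-1 * u) -  exp (-1 * u) * (exp (-a * u) * exp (-a * u))) / (1 + 2 * a - 1)))) := by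
      rw [← this, ← mul_assoc, e3, one_mul]
    have h5 : ((exp (-1 * u) -  exp (-1 * u) * (exp (-a * u) * exp (-a * u))) / (1 + 2 * a - 1)) =
       exp (-1 * u) * (1 - exp (-a * u) * exp (-a * u)) / (2 * a) := by
      congr 1 <;> ring
    rw [h5] at h4
    have h6 : JJ z0 a u = G z0 * (exp (-a * u) / (2 * a)) - exp (a * u) * (exp u * TT z0 a u) +
       exp (a * u) * G z0 * ((exp u * exp (-1 * u)) * (1 - exp (-a * u) * exp (-a * u)) / (2 * a)) := by
      linear_combination -h4
    rw [h6, e2]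
    linear_combination (-(G z0) * exp (-a * u) / (2 * a)) * e3
  obtain ⟨iu, -⟩ := J_T_identity RH hz0 ha ha2 u
  obtain ⟨in_, -⟩ := J_T_identity RH hz0 ha ha2 (-u)
  obtain ⟨i0, -⟩ := J_T_identity RH hz0 ha ha2 0
  have hJ0 := hneg 0 le_rfl
  have hJn := hneg (-u) (by linarith)
  set P : ℝ → ℝ := fun v => (G (z0 - a + v * I)).re / (a ^ 2 + v ^ 2) with hP
  have hP0 : ∀ v, 0 ≤ P v := by
    intro v
    refine div_nonneg (G_re_nonneg RH ?_) (by positivity)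
    simp [hz0]; linarith
  have hsum : JJ z0 a u + (starRingEnd ℂ) (JJ z0 a (-u)) =
      (1 / (2 * Real.pi) : ℂ) * ∫ v : ℝ, exp (u * v * I) * (2 * P v : ℝ) := by
    unfold JJ
    rw [map_mul, ← integral_conj]
    have : (starRingEnd ℂ) (1 / (2 * Real.pi) : ℂ) = 1 / (2 * Real.pi) := by simp [Complex.conj_ofNat]
    rw [this, ← mul_add]
    have ic := (Complex.conjCLE.toContinuousLinearMap.integrable_comp in_)
    have ic' : Integrable (fun v : ℝ => (starRingEnd ℂ) (exp ((-u : ℝ) * v * I) * (G (z0 - a + v * I) / (a ^ 2 + v ^ 2)))) := ic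
    rw [← integral_add iu ic']
    congr 2; funext v
    rw [map_mul, ← exp_conj, map_div₀]
    have c1 : (starRingEnd ℂ) ((-u : ℝ) * v * I) = u * v * I := by simp
    have c2 : (starRingEnd ℂ) (a ^ 2 + v ^ 2 : ℂ) = a ^ 2 + v ^ 2 := by simp
    rw [c1, c2, ← mul_add, ← add_div, add_conj]
    congr 1
    simp only [hP]; push_cast; ring
  have hre : ∫ v : ℝ, P v = Real.pi * ((G z0).re / a) := by
    have h1 : (JJ z0 a 0).re = (1 / (2 * Real.pi)) * ∫ v : ℝ, P v := by
      have h2 : ∫ v : ℝ, P v = (∫ v : ℝ, exp ((0 : ℝ) * v * I) * (G (z0 - a + v * I) / (a ^ 2 + v ^ 2))).re := by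
        have := integral_re i0
        simp only [RCLike.re_to_complex] at this
        rw [← this]
        congr 1; funext v
        simp only [hP, ofReal_zero, zero_mul, exp_zero, one_mul]
        have : (a ^ 2 + v ^ 2 : ℂ) = ((a ^ 2 + v ^ 2 : ℝ) : ℂ) := by push_cast; rfl
        rw [this, div_ofReal_re]
      rw [h2]
      unfold JJ
      have : (1 / (2 * Real.pi) : ℂ) = ((1 / (2 * Real.pi) : ℝ) : ℂ) := by push_cast; rfl
      rw [this, re_ofReal_mul]
    rw [hJ0] at h1
    have h3 : (G z0 * (exp (a * (0 : ℝ)) / (2 * a))).re = (G z0).re / (2 * a) := by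
      have : G z0 * (exp (a * (0 : ℝ)) / (2 * a)) = G z0 / ((2 * a : ℝ) : ℂ) := by
        simp; ring
      rw [this, div_ofReal_re]
    rw [h3] at h1
    have := Real.pi_pos
    field_simp at h1 ⊢
    linarith
  have hbound : ‖JJ z0 a u + (starRingEnd ℂ) (JJ z0 a (-u))‖ ≤ (G z0).re / a := by
    rw [hsum, norm_mul]
    have h1 : ‖(1 / (2 * Real.pi) : ℂ)‖ = 1 / (2 * Real.pi) := by
      rw [norm_div, norm_mul, norm_real, Real.norm_of_nonneg Real.pi_pos.le]; simp
    have h2 : ‖∫ v : ℝ, exp (u * v * I) * (2 * P v : ℝ)‖ ≤ ∫ v : ℝ, 2 * P v := by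
      refine (norm_integral_le_integral_norm _).trans (le_of_eq ?_)
      congr 1; funext v
      rw [norm_mul, norm_exp, norm_real, Real.norm_of_nonneg (by have := hP0 v; positivity)]
      simp
    rw [integral_const_mul, hre] at h2
    rw [h1]
    calc _ ≤ 1 / (2 * Real.pi) * (2 * (Real.pi * ((G z0).re / a))) := by gcongr
      _ = _ := by have := Real.pi_pos; field_simp
  rw [hpos, hJn] at hbound
  have hc : (starRingEnd ℂ) (G z0 * (exp (a * (-u : ℝ)) / (2 * a))) =
      (starRingEnd ℂ) (G z0) * (exp (-a * u) / (2 * a)) := by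
    rw [map_mul, map_div₀, ← exp_conj]; simp [Complex.conj_ofNat]
  rw [hc] at hbound
  have e2 : exp (-(2 * a) * u) = exp (-a * u) * exp (-a * u) := by
    rw [← exp_add]; congr 1; ring
  have e3 : exp (-a * u) * exp (a * u) = 1 := by rw [← exp_add]; simp
  have key : G z0 - 2 * a * (exp u * TT z0 a u) + exp (-(2 * a) * u) * (starRingEnd ℂ) (G z0) =
      (2 * a * exp (-a * u)) * (exp (a * u) * (G z0 / (2 * a) - exp u * TT z0 a u) +
        (starRingEnd ℂ) (G z0) * (exp (-a * u) / (2 * a))) := by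
    rw [e2]
    have : G z0 = 2 * a * (G z0 / (2 * a)) := by field_simp
    have h7 : (starRingEnd ℂ) (G z0) = 2 * a * ((starRingEnd ℂ) (G z0) / (2 * a)) := by field_simp
    linear_combination this - 2 * a * (G z0 / (2 * a) - exp u * TT z0 a u) * e3 + exp (-a * u) * exp (-a * u) * h7
  rw [key, norm_mul]
  have hn : ‖(2 * a * exp (-a * u) : ℂ)‖ = 2 * a * Real.exp (-a * u) := by
    rw [norm_mul, norm_mul, norm_real, norm_exp, Real.norm_of_nonneg ha.le]; simp
  rw [hn]
  calc _ ≤ 2 * a * Real.exp (-a * u) * ((G z0).re / a) := by gcongr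
    _ = _ := by field_simp

end PMZ


namespace PMZ
open Filter Topology Set MeasureTheory

noncomputable def Lf (a u : ℝ) (g : ℝ → ℂ) : ℂ :=
  2 * a * ((1 / (2 * Real.pi) : ℂ) * ∫ v : ℝ, exp (u * v * I) *
    (g v * (1 / ((1 + v * I) * (1 + 2 * a + v * I)))))

def Nice (g : ℝ → ℂ) : Prop := Continuous g ∧ ∃ D : ℝ, ∀ v, ‖g v‖ ≤ D

lemma Nice.add {f g : ℝ → ℂ} (hf : Nice f) (hg : Nice g) : Nice (fun v => f v + g v) := by
  obtain ⟨h1, D1, h2⟩ := hf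
  obtain ⟨h3, D2, h4⟩ := hg
  exact ⟨h1.add h3, D1 + D2, fun v => (norm_add_le _ _).trans (add_le_add (h2 v) (h4 v))⟩

lemma Nice.neg {f : ℝ → ℂ} (hf : Nice f) : Nice (fun v => -f v) := by
  obtain ⟨h1, D1, h2⟩ := hf
  exact ⟨h1.neg, D1, fun v => by rw [norm_neg]; exact h2 v⟩

lemma nice_const (c : ℂ) : Nice (fun _ => c) := ⟨continuous_const, ‖c‖, fun _ => le_rfl⟩

lemma nice_inv {p : ℂ} (hp : 0 < p.re) : Nice (fun v : ℝ => 1 / (p + v * I)) := by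
  refine ⟨continuous_const.div (by fun_prop) (A_ne hp), 1 / p.re, fun v => ?_⟩
  rw [norm_div, norm_one]
  apply one_div_le_one_div_of_le hp
  have := re_le_norm (p + v * I)
  simpa using this

lemma nice_exp (c : ℂ) (r : ℝ) : Nice (fun v : ℝ => c * exp (-(r * v) * I)) := by
  refine ⟨by fun_prop, ‖c‖, fun v => ?_⟩
  rw [norm_mul, norm_exp]; simp

lemma re12 {a : ℝ} (ha : 0 < a) : 0 < (1 + 2 * a : ℂ).re := by simp; linarith

lemma nice_integrable {a : ℝ} (ha : 0 < a) (u : ℝ) {g : ℝ → ℂ} (hg : Nice g) :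
    Integrable (fun v : ℝ => exp (u * v * I) *
      (g v * (1 / ((1 + v * I) * (1 + 2 * a + v * I))))) := by
  obtain ⟨h1, D1, h2⟩ := hg
  exact integrable_osc ((integrable_H (A := 1) (B := 1 + 2 * a) (by simp) (re12 ha)).bdd_mul
    h1.aestronglyMeasurable (ae_of_all _ h2)) u

lemma Lf_add {a : ℝ} (ha : 0 < a) (u : ℝ) {f g : ℝ → ℂ} (hf : Nice f) (hg : Nice g) :
    Lf a u (fun v => f v + g v) = Lf a u f + Lf a u g := by
  unfold Lf
  rw [← mul_add, ← mul_add, ← integral_add (nice_integrable ha u hf) (nice_integrable ha u hg)]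
  congr 3; funext v; ring

lemma Lf_neg (a u : ℝ) (f : ℝ → ℂ) :
    Lf a u (fun v => -f v) = -Lf a u f := by
  unfold Lf
  rw [← mul_neg, ← mul_neg, ← integral_neg]
  congr 3; funext v; ring

noncomputable def KK (a u : ℝ) : ℂ := if 0 ≤ u then exp (-u) - exp (-(1 + 2 * a) * u) else 0

lemma Lf_exp {a : ℝ} (ha : 0 < a) (u : ℝ) (c : ℂ) (r : ℝ) :
    Lf a u (fun v : ℝ => c * exp (-(r * v) * I)) = c * KK a (u - r) := by
  have haC : (a : ℂ) ≠ 0 := by exact_mod_cast ha.ne'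
  have h := ker_exp (A := 1) (B := 1 + 2 * a) (by simp) (re12 ha) (by simpa using haC) (u - r)
  unfold Lf
  have e : ∀ v : ℝ, exp (u * v * I) * (c * exp (-(r * v) * I) *
      (1 / ((1 + v * I) * (1 + 2 * a + v * I)))) =
      c * (exp ((u - r : ℝ) * v * I) * (1 / ((1 + v * I) * (1 + 2 * a + v * I)))) := by
    intro v
    have : exp ((u - r : ℝ) * v * I) = exp (u * v * I) * exp (-(r * v) * I) := by
      rw [← exp_add]; congr 1; push_cast; ring
    rw [this]; ring
  simp_rw [e]
  rw [integral_const_mul]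
  have : (2 * a * ((1 / (2 * Real.pi) : ℂ) * (c * ∫ v : ℝ, (exp ((u - r : ℝ) * v * I) *
    (1 / ((1 + v * I) * (1 + 2 * a + v * I))))))) = c * (2 * a * ((1 / (2 * Real.pi) : ℂ) * ∫ v : ℝ,
     (exp ((u - r : ℝ) * v * I) * (1 / ((1 + v * I) * (1 + 2 * a + v * I)))))) := by ring
  rw [this, h]
  congr 1
  unfold KK
  split_ifs
  · rw [show (1 + 2 * a - 1 : ℂ) = 2 * a by ring, mul_div_cancel₀ _ (by simpa using haC)]
    congr 2; ring
  · simp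

lemma Lf_const {a : ℝ} (ha : 0 < a) (u : ℝ) (c : ℂ) :
    Lf a u (fun _ : ℝ => c) = c * KK a u := by
  have := Lf_exp ha u c 0
  simpa using this

noncomputable def trip (a u : ℝ) (p : ℂ) : ℂ :=
  if 0 ≤ u then
    (if p = 0 then u * exp (-u) - (exp (-u) - exp (-(1 + 2 * a) * u)) / (2 * a)
     else (exp (-u) - exp (-(1 + p) * u)) / p -
      (exp (-(1 + 2 * a) * u) - exp (-(1 + p) * u)) / (p - 2 * a))
  else 0

lemma Lf_inv {a : ℝ} (ha : 0 < a) (u : ℝ) {p : ℂ} (hp : 0 ≤ p.re) (hpa : p ≠ 2 * a) :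
    Lf a u (fun v : ℝ => 1 / (1 + p + v * I)) = trip a u p := by
  have haC : (a : ℂ) ≠ 0 := by exact_mod_cast ha.ne'
  have hp1 : 0 < (1 + p).re := by simp; linarith
  have i1 := integrable_osc (integrable_H (A := 1) (B := 1 + p) (by simp) hp1) u
  have i2 := integrable_osc (integrable_H (A := 1 + 2 * a) (B := 1 + p) (re12 ha) hp1) u
  have e : ∀ v : ℝ, exp (u * v * I) * (1 / (1 + p + v * I) *
      (1 / ((1 + v * I) * (1 + 2 * a + v * I)))) = (1 / (2 * a)) *
      (exp (u * v * I) * (1 / ((1 + v * I) * (1 + p + v * I))) -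
      exp (u * v * I) * (1 / ((1 + 2 * a + v * I) * (1 + p + v * I)))) := by
    intro v
    have h1 := A_ne (A := 1) (by simp) v
    have h2 := A_ne hp1 v
    have h3 := A_ne (re12 ha) v
    field_simp
    ring
  unfold Lf
  simp_rw [e]
  rw [integral_const_mul, integral_sub i1 i2]
  have hk2 := ker_exp (A := 1 + 2 * a) (B := 1 + p) (re12 ha) hp1
    (by intro h; exact hpa (add_left_cancel h).symm) u
  have hk1 : (1 / (2 * Real.pi) : ℂ) * ∫ v : ℝ, exp (u * v * I) * (1 / ((1 + v * I) * (1 + p + v * I))) =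
      if 0 ≤ u then (if p = 0 then u * exp (-u) else (exp (-u) - exp (-(1 + p) * u)) / p) else 0 := by
    by_cases h0 : p = 0
    · subst h0
      simp only [add_zero, if_true]
      exact ker_exp_double u
    · rw [ker_exp (A := 1) (B := 1 + p) (by simp) hp1 (by simpa using h0) u]
      simp only [if_neg h0, add_sub_cancel_left, neg_mul, one_mul]
  have : (2 * a * ((1 / (2 * Real.pi) : ℂ) * (1 / (2 * a) * ((∫ v : ℝ, exp (u * v * I) * (1 / ((1 + v * I) * (1 + p + v * I)))) -
      ∫ v : ℝ, exp (u * v * I) * (1 / ((1 + 2 * a + v * I) * (1 + p + v * I))))))) =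
      (1 / (2 * Real.pi) : ℂ) * (∫ v : ℝ, exp (u * v * I) * (1 / ((1 + v * I) * (1 + p + v * I)))) -
      (1 / (2 * Real.pi) : ℂ) * ∫ v : ℝ, exp (u * v * I) * (1 / ((1 + 2 * a + v * I) * (1 + p + v * I))) := by
    generalize (∫ v : ℝ, exp (u * v * I) * (1 / ((1 + v * I) * (1 + p + v * I)))) = Q1
    generalize (∫ v : ℝ, exp (u * v * I) * (1 / ((1 + 2 * a + v * I) * (1 + p + v * I)))) = Q2
    field_simp
  rw [this, hk1, hk2]
  unfold trip
  split_ifs with h1 h2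
  · subst h2
    congr 1
    simp only [add_zero, mul_one, neg_mul, one_mul]
    rw [show (1 - (1 + 2 * a) : ℂ) = -(2 * a) by ring, div_neg, ← neg_div, neg_sub]
  · rw [show (1 + p - (1 + 2 * a) : ℂ) = p - 2 * a by ring]
  · simp

lemma KK_nonpos {a u : ℝ} (hu : u ≤ 0) : KK a u = 0 := by
  unfold KK; split_ifs with h
  · have : u = 0 := le_antisymm hu h
    simp [this]
  · rfl

lemma trip_nonpos {a u : ℝ} (p : ℂ) (hu : u ≤ 0) : trip a u p = 0 := by
  unfold trip; split_ifs with h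
  · have : u = 0 := le_antisymm hu h
    simp [this]
  · have : u = 0 := le_antisymm hu h
    simp [this]
  · rfl

lemma integrable_sqrt_kk {a : ℝ} (ha : 0 < a) :
    Integrable (fun v : ℝ => Real.sqrt (1 + |v|) * ‖(1 / ((1 + v * I) * (1 + 2 * a + v * I)) : ℂ)‖) := by
  have h : Integrable (fun v : ℝ => ((Real.sqrt (1 + |v|) : ℝ) : ℂ) *
      (1 / ((1 + v * I) * (1 + 2 * a + v * I)))) := by
    refine integrable_of_decay (C := 4) ?_ (by norm_num) (fun v hv => ?_)
    · refine Continuous.mul (by fun_prop) (continuous_const.div (by fun_prop) fun v => ?_)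
      exact mul_ne_zero (A_ne (A := 1) (by simp) v) (A_ne (re12 ha) v)
    · have n1 : (1 + |v|) / 2 ≤ ‖(1 + v * I : ℂ)‖ := by
        have := abs_im_le_norm (1 + v * I : ℂ); simp at this; linarith
      have n2 : (1 + |v|) / 2 ≤ ‖(1 + 2 * a + v * I : ℂ)‖ := by
        have := abs_im_le_norm (1 + 2 * a + v * I : ℂ); simp at this; linarith
      have hp : 0 < 1 + |v| := by positivity
      have hr : (1 + |v|) ^ (-(3 / 2) : ℝ) = Real.sqrt (1 + |v|) / (1 + |v|) ^ 2 := by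
        rw [Real.sqrt_eq_rpow, ← Real.rpow_natCast (1 + |v|) 2, ← Real.rpow_sub hp]; norm_num
      rw [norm_mul, norm_div, norm_mul, norm_one, norm_real, Real.norm_of_nonneg (Real.sqrt_nonneg _)]
      calc _ ≤ Real.sqrt (1 + |v|) * (1 / ((1 + |v|) / 2 * ((1 + |v|) / 2))) := by gcongr
        _ = _ := by rw [hr]; field_simp; ring
  refine h.norm.congr (ae_of_all _ fun v => ?_)
  simp only [norm_mul, norm_real, Real.norm_of_nonneg (Real.sqrt_nonneg _)]

lemma Lf_hasSum {a : ℝ} (ha : 0 < a) (u : ℝ) {F : ℕ → ℝ → ℂ} {g : ℝ → ℂ} {b : ℕ → ℝ}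
    (hF : ∀ n, Nice (F n)) (hb : Summable b) (hFb : ∀ n v, ‖F n v‖ ≤ b n * Real.sqrt (1 + |v|))
    (hg : ∀ v, HasSum (fun n => F n v) (g v)) :
    HasSum (fun n => Lf a u (F n)) (Lf a u g) := by
  unfold Lf
  refine HasSum.mul_left _ (HasSum.mul_left _ ?_)
  have h := hasSum_integral_of_summable_integral_norm (μ := volume)
    (F := fun n (v : ℝ) => exp (u * v * I) * (F n v * (1 / ((1 + v * I) * (1 + 2 * a + v * I)))))
    (fun n => nice_integrable ha u (hF n)) ?_
  · convert! h using 3 with v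
    rw [tsum_mul_left, tsum_mul_right, (hg v).tsum_eq]
  · refine Summable.of_nonneg_of_le (fun n => integral_nonneg fun v => norm_nonneg _) (fun n => ?_)
      (hb.mul_right (∫ v : ℝ, Real.sqrt (1 + |v|) * ‖(1 / ((1 + v * I) * (1 + 2 * a + v * I)) : ℂ)‖))
    rw [← integral_const_mul]
    refine integral_mono (nice_integrable ha u (hF n)).norm ((integrable_sqrt_kk ha).const_mul _)
      (fun v => ?_)
    simp only
    rw [norm_mul, norm_mul, norm_exp]
    have : Real.exp ((u * v * I : ℂ)).re = 1 := by simp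
    rw [this, one_mul, ← mul_assoc]
    gcongr
    exact hFb n v

end PMZ


namespace PMZ
open Filter Topology Set MeasureTheory

noncomputable def vM (n : ℕ) : ℂ := ((ArithmeticFunction.vonMangoldt n : ℝ) : ℂ)

lemma term_vM (t v : ℝ) (n : ℕ) : LSeries.term vM (2 + t * I + v * I) n =
    LSeries.term vM (2 + t * I) n * exp (-((Real.log n : ℝ) * v) * I) := by
  rcases eq_or_ne n 0 with rfl | hn
  · simp
  · rw [LSeries.term_of_ne_zero hn, LSeries.term_of_ne_zero hn]
    have hnC : (n : ℂ) ≠ 0 := by exact_mod_cast hn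
    rw [cpow_add _ _ hnC, div_mul_eq_div_div, div_eq_mul_inv (vM n / _)]
    congr 1
    rw [cpow_def_of_ne_zero hnC, ← exp_neg, natCast_log]
    congr 1; ring

noncomputable def c0 : ℂ := -Real.eulerMascheroniConstant / 2 - Real.log Real.pi / 2

noncomputable def pk (t : ℝ) (k : ℕ) : ℂ := 1 + t * I + 2 * (k + 1)

lemma pk_re (t : ℝ) (k : ℕ) : (pk t k).re = 2 * k + 3 := by
  unfold pk; simp; ring

lemma pk_im (t : ℝ) (k : ℕ) : (pk t k).im = t := by
  unfold pk; simp

lemma TT_hasSum (RH : RiemannHypothesis) {a : ℝ} (ha : 0 < a) (ha2 : a < 1 / 2) (t u : ℝ) :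
    HasSum (fun k : ℕ => -(LSeries.term vM (2 + t * I) k * KK a (u - Real.log k)) +
      (1 / (2 * ((k : ℂ) + 1)) * KK a u - trip a u (pk t k)) +
      (if k = 0 then c0 * KK a u + trip a u (t * I) else 0)) (2 * a * TT (1 / 2 + t * I) a u) := by
  have hTT : 2 * a * TT (1 / 2 + t * I) a u = Lf a u (fun v : ℝ => G (1 / 2 + t * I + 1 + v * I)) := rfl
  rw [hTT]
  set F : ℕ → ℝ → ℂ := fun k v => (-(LSeries.term vM (2 + t * I) k * exp (-((Real.log k : ℝ) * v) * I)) +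
      (1 / (2 * ((k : ℂ) + 1)) + -(1 / (1 + pk t k + v * I)))) +
      (if k = 0 then c0 + 1 / (1 + t * I + v * I) else 0) with hF
  have ht1 : 0 < (1 + t * I : ℂ).re := by simp
  have hk1 : ∀ k, 0 < (1 + pk t k).re := by
    intro k; rw [add_re, pk_re, one_re]; positivity
  have nA : ∀ k : ℕ, Nice (fun v : ℝ => -(LSeries.term vM (2 + t * I) k * exp (-((Real.log k : ℝ) * v) * I))) :=
    fun k => (nice_exp _ _).neg
  have nI : ∀ k : ℕ, Nice (fun v : ℝ => -(1 / (1 + pk t k + v * I))) := fun k => (nice_inv (hk1 k)).neg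
  have nB : ∀ k : ℕ, Nice (fun v : ℝ => 1 / (2 * ((k : ℂ) + 1)) + -(1 / (1 + pk t k + v * I))) :=
    fun k => (nice_const _).add (nI k)
  have nC : ∀ k : ℕ, Nice (fun v : ℝ => if k = 0 then c0 + 1 / (1 + t * I + v * I) else 0) := by
    intro k
    by_cases h : k = 0
    · simp only [h, if_true]; exact (nice_const _).add (nice_inv ht1)
    · simp only [h, if_false]; exact nice_const _
  have nF : ∀ k, Nice (F k) := fun k => ((nA k).add (nB k)).add (nC k)
  have hval : ∀ k, Lf a u (F k) = -(LSeries.term vM (2 + t * I) k * KK a (u - Real.log k)) +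
      (1 / (2 * ((k : ℂ) + 1)) * KK a u - trip a u (pk t k)) +
      (if k = 0 then c0 * KK a u + trip a u (t * I) else 0) := by
    intro k
    rw [hF]
    rw [Lf_add ha u ((nA k).add (nB k)) (nC k), Lf_add ha u (nA k) (nB k), Lf_neg, Lf_exp ha,
      Lf_add ha u (nice_const _) (nI k), Lf_const ha, Lf_neg,
      Lf_inv ha u (by rw [pk_re]; positivity) (by
        intro h
        have := congrArg re h
        rw [pk_re] at this
        simp at this
        have hk : (0 : ℝ) ≤ k := by positivity
        linarith), ← sub_eq_add_neg]
    congr 1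
    split_ifs with h
    · rw [Lf_add ha u (nice_const _) (nice_inv ht1), Lf_const ha, Lf_inv ha u (by simp) (by
        intro h
        have := congrArg re h
        simp at this
        linarith)]
    · rw [Lf_const ha, zero_mul]
  have key : HasSum (fun k => Lf a u (F k)) (Lf a u (fun v : ℝ => G (1 / 2 + t * I + 1 + v * I))) := by
    obtain ⟨D, hD⟩ := ((nice_const c0).add (nice_inv ht1)).2
    have hD0 : 0 ≤ D := (norm_nonneg _).trans (hD 0)
    refine Lf_hasSum ha u (b := fun k : ℕ => ‖LSeries.term vM (2 + t * I) k‖ +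
      Real.sqrt (3 + |t|) * (1 / ((k : ℝ) + 1) ^ (3 / 2 : ℝ)) + (if k = 0 then D else 0)) nF ?_ ?_ ?_
    · refine Summable.add (Summable.add ?_ (summ_32.mul_left _)) (hasSum_ite_eq 0 D).summable
      have := ArithmeticFunction.LSeriesSummable_vonMangoldt (s := 2 + t * I) (by simp)
      exact Summable.norm this
    · intro k v
      have hs1 : 1 ≤ Real.sqrt (1 + |v|) := Real.one_le_sqrt.2 (by have := abs_nonneg v; linarith)
      have b1 : ‖-(LSeries.term vM (2 + t * I) k * exp (-((Real.log k : ℝ) * v) * I))‖ ≤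
          ‖LSeries.term vM (2 + t * I) k‖ * Real.sqrt (1 + |v|) := by
        rw [norm_neg, norm_mul, norm_exp]
        have : (-((Real.log k : ℝ) * v) * I : ℂ).re = 0 := by
          generalize Real.log k = r
          simp
        rw [this, Real.exp_zero]
        gcongr
      have b2 : ‖1 / (2 * ((k : ℂ) + 1)) + -(1 / (1 + pk t k + v * I))‖ ≤
          Real.sqrt (3 + |t|) * (1 / ((k : ℝ) + 1) ^ (3 / 2 : ℝ)) * Real.sqrt (1 + |v|) := by
        have h := Psi_term_bound (s := 2 + t * I + v * I) (by simp) k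
        have e : 1 + pk t k + v * I = 2 + t * I + v * I + 2 * (k + 1) := by unfold pk; ring
        rw [e, ← sub_eq_add_neg]
        refine h.trans ?_
        have : Real.sqrt (1 + ‖(2 + t * I + v * I : ℂ)‖) ≤ Real.sqrt (3 + |t|) * Real.sqrt (1 + |v|) := by
          rw [← Real.sqrt_mul (by positivity)]
          apply Real.sqrt_le_sqrt
          have h3 : ‖(2 + t * I + v * I : ℂ)‖ ≤ ‖(2 : ℂ)‖ + ‖(t * I : ℂ)‖ + ‖(v * I : ℂ)‖ := norm_add₃_le
          simp at h3
          nlinarith [abs_nonneg t, abs_nonneg v]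
        calc _ ≤ (Real.sqrt (3 + |t|) * Real.sqrt (1 + |v|)) * (1 / ((k : ℝ) + 1) ^ (3 / 2 : ℝ)) := by gcongr
          _ = _ := by ring
      have b3 : ‖(if k = 0 then c0 + 1 / (1 + t * I + v * I) else 0 : ℂ)‖ ≤
          (if k = 0 then D else 0) * Real.sqrt (1 + |v|) := by
        split_ifs
        · exact (hD v).trans (le_mul_of_one_le_right hD0 hs1)
        · simp
      calc ‖F k v‖ ≤ _ := norm_add₃_le
        _ ≤ _ := add_le_add (add_le_add b1 b2) b3
        _ = _ := by ring
    · intro v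
      have e : (1 / 2 + t * I + 1 + v * I : ℂ) = (2 + t * I + v * I) - 1 / 2 := by ring
      have hre : (2 + t * I + v * I : ℂ).re = 2 := by simp
      rw [e, G_eq RH (by rw [hre]; norm_num) (by
        intro h; have := congrArg re h; rw [hre] at this; norm_num at this)]
      have hL := ArithmeticFunction.LSeries_vonMangoldt_eq_deriv_riemannZeta_div
        (s := 2 + t * I + v * I) (by rw [hre]; norm_num)
      have hLs := (ArithmeticFunction.LSeriesSummable_vonMangoldt (s := 2 + t * I + v * I)
        (by rw [hre]; norm_num)).hasSum
      have hLs' : HasSum (fun k => LSeries.term vM (2 + t * I + v * I) k)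
        (-deriv riemannZeta (2 + t * I + v * I) / riemannZeta (2 + t * I + v * I)) := by
        rw [← hL]; exact hLs
      have hP := (Psi_summable (s := 2 + t * I + v * I) (by rw [hre]; norm_num)).hasSum
      have := (hLs'.neg.add hP).add (hasSum_ite_eq (0 : ℕ) (c0 + 1 / (1 + t * I + v * I)))
      convert! this using 1
      · funext k
        rw [hF]
        simp only [term_vM]
        have e : 1 + pk t k + v * I = 2 + t * I + v * I + 2 * (k + 1) := by unfold pk; ring
        rw [e, ← sub_eq_add_neg]
      · unfold Psi c0
        rw [show (2 + t * I + v * I - 1 : ℂ) = 1 + t * I + v * I by ring]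
        ring
  exact (funext hval) ▸ key

lemma TT_nonpos (RH : RiemannHypothesis) {a : ℝ} (ha : 0 < a) (ha2 : a < 1 / 2) (t : ℝ) {u : ℝ}
    (hu : u ≤ 0) : TT (1 / 2 + t * I) a u = 0 := by
  have h := TT_hasSum RH ha ha2 t u
  have haC : (a : ℂ) ≠ 0 := by exact_mod_cast ha.ne'
  have e : ∀ k : ℕ, KK a (u - Real.log k) = 0 := fun k => KK_nonpos (by
    have : 0 ≤ Real.log k := Real.log_natCast_nonneg k
    linarith)
  simp only [e, KK_nonpos hu, trip_nonpos _ hu, mul_zero, neg_zero, sub_zero, add_zero, ite_self] at h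
  have := h.unique hasSum_zero
  simpa [haC] using this

noncomputable def SS (a u t : ℝ) (k : ℕ) : ℂ :=
  LSeries.term vM (2 + t * I) k * (exp u * KK a (u - Real.log k))

noncomputable def triv (a u t : ℝ) (k : ℕ) : ℂ :=
  2 * a * exp (-(pk t k) * u) / (pk t k * (pk t k - 2 * a))

noncomputable def poleE (a u t : ℝ) : ℂ := exp u * trip a u (t * I)

lemma TT_eval (RH : RiemannHypothesis) {a : ℝ} (ha : 0 < a) (ha2 : a < 1 / 2) (t : ℝ) {u : ℝ}
    (hu : 0 ≤ u) : HasSum (fun k => SS a u t k + triv a u t k)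
      (Psi (1 + t * I) - exp (-(2 * a) * u) * Psi (1 + t * I - 2 * a) + poleE a u t -
        2 * a * (exp u * TT (1 / 2 + t * I) a u)) := by
  have h := (TT_hasSum RH ha ha2 t u).mul_left (exp u)
  have hP1 := (Psi_summable (s := 1 + t * I) (by simp)).hasSum
  have hP2 := ((Psi_summable (s := 1 + t * I - 2 * a) (by simp; linarith)).hasSum).mul_left
    (exp (-(2 * a) * u))
  have h3 := hasSum_ite_eq (0 : ℕ) (c0 * (1 - exp (-(2 * a) * u)) + poleE a u t)
  have h4 := ((hP1.sub hP2).add h3).sub h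
  have eK : exp u * KK a u = 1 - exp (-(2 * a) * u) := by
    unfold KK
    rw [if_pos hu, mul_sub, ← exp_add, ← exp_add]
    congr 1
    · simp
    · congr 1; ring
  convert! h4 using 1
  · funext k
    have hp : pk t k ≠ 0 := by
      intro h
      have := congrArg re h
      rw [pk_re] at this
      simp at this
      have hk : (0 : ℝ) ≤ k := by positivity
      linarith
    have hp2 : pk t k - 2 * a ≠ 0 := by
      intro h
      have := congrArg re h
      rw [sub_re, pk_re] at this
      simp at this
      have hk : (0 : ℝ) ≤ k := by positivity
      linarith
    have eT : exp u * trip a u (pk t k) = (1 - exp (-(pk t k) * u)) / pk t k -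
        (exp (-(2 * a) * u) - exp (-(pk t k) * u)) / (pk t k - 2 * a) := by
      unfold trip
      rw [if_pos hu, if_neg hp, mul_sub, mul_div_assoc', mul_div_assoc', mul_sub, mul_sub]
      simp only [← exp_add]
      congr 3
      · simp
      · congr 1; ring
      · congr 1; ring
      · congr 1; ring
    have e1 : (1 + t * I + 2 * (k + 1) : ℂ) = pk t k := rfl
    have e2 : (1 + t * I - 2 * a + 2 * (k + 1) : ℂ) = pk t k - 2 * a := by unfold pk; ring
    rw [e1, e2]
    have e3 : (if k = 0 then c0 * (1 - exp (-(2 * a) * u)) + poleE a u t else 0) =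
        exp u * (if k = 0 then c0 * KK a u + trip a u (t * I) else 0) := by
      split_ifs
      · unfold poleE; rw [← eK]; ring
      · simp
    rw [e3]
    have e4 : exp u * (-(LSeries.term vM (2 + t * I) k * KK a (u - Real.log k)) +
      (1 / (2 * ((k : ℂ) + 1)) * KK a u - trip a u (pk t k)) +
      (if k = 0 then c0 * KK a u + trip a u (t * I) else 0)) =
        -(SS a u t k) + (1 / (2 * ((k : ℂ) + 1)) * (exp u * KK a u) - exp u * trip a u (pk t k)) +
        exp u * (if k = 0 then c0 * KK a u + trip a u (t * I) else 0) := by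
      unfold SS; ring
    rw [e4, eK, eT]
    unfold triv
    have hk := k1_ne k
    field_simp
    ring
  · unfold Psi c0
    ring

end PMZ


namespace PMZ
open Filter Topology Set MeasureTheory

noncomputable def KKr (a u : ℝ) : ℝ := if 0 ≤ u then Real.exp (-u) - Real.exp (-(1 + 2 * a) * u) else 0

lemma KK_ofReal (a u : ℝ) : KK a u = (KKr a u : ℂ) := by
  unfold KK KKr
  split_ifs <;> push_cast <;> rfl

lemma KKr_nonneg {a : ℝ} (ha : 0 < a) (u : ℝ) : 0 ≤ KKr a u := by
  unfold KKr
  split_ifs with h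
  · rw [sub_nonneg]; apply Real.exp_le_exp.2; nlinarith
  · rfl

noncomputable def Sr (a u : ℝ) (k : ℕ) : ℝ :=
  ‖LSeries.term vM 2 k‖ * (Real.exp u * KKr a (u - Real.log k))

lemma Sr_nonneg {a : ℝ} (ha : 0 < a) (u : ℝ) (k : ℕ) : 0 ≤ Sr a u k := by
  unfold Sr; have := KKr_nonneg ha (u - Real.log k); positivity

lemma SS_zero (a u : ℝ) (k : ℕ) : SS a u 0 k = (Sr a u k : ℂ) := by
  unfold SS Sr
  rw [KK_ofReal]
  push_cast
  congr 1
  have : (2 + (0 : ℂ) * I) = 2 := by simp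
  rw [this]
  rcases eq_or_ne k 0 with rfl | hk
  · simp
  · rw [LSeries.term_of_ne_zero hk]
    have e : (k : ℂ) ^ (2 : ℂ) = (((k : ℝ) ^ 2 : ℝ) : ℂ) := by
      rw [show (2 : ℂ) = ((2 : ℕ) : ℂ) by norm_num, cpow_natCast]; push_cast; rfl
    rw [e, vM, ← ofReal_div, norm_real, Real.norm_of_nonneg]
    exact div_nonneg ArithmeticFunction.vonMangoldt_nonneg (by positivity)

lemma norm_SS {a : ℝ} (ha : 0 < a) (u t : ℝ) (k : ℕ) : ‖SS a u t k‖ = Sr a u k := by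
  unfold SS Sr
  have h1 := KKr_nonneg ha (u - Real.log k)
  rw [KK_ofReal, norm_mul, norm_mul, norm_real, Real.norm_of_nonneg h1, norm_exp, ofReal_re]
  congr 1
  rw [LSeries.norm_term_eq, LSeries.norm_term_eq]
  simp

noncomputable def trr (a u : ℝ) (k : ℕ) : ℝ :=
  2 * a * Real.exp (-(2 * k + 3) * u) / ((2 * k + 3) * (2 * k + 3 - 2 * a))

lemma triv_zero (a u : ℝ) (k : ℕ) : triv a u 0 k = (trr a u k : ℂ) := by
  have : pk 0 k = ((2 * k + 3 : ℝ) : ℂ) := by unfold pk; push_cast; ring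
  unfold triv trr
  rw [this]; push_cast; rfl

lemma exp_pow_eq (u : ℝ) (k : ℕ) :
    Real.exp (-(2 * k + 3) * u) = Real.exp (-3 * u) * Real.exp (-2 * u) ^ k := by
  rw [← Real.exp_nat_mul, ← Real.exp_add]; congr 1; ring

lemma geo {u : ℝ} (hu : 0 < u) (c : ℝ) :
    HasSum (fun k : ℕ => c * (Real.exp (-3 * u) * Real.exp (-2 * u) ^ k))
      (c * (Real.exp (-3 * u) / (1 - Real.exp (-2 * u)))) := by
  rw [div_eq_mul_inv]
  refine HasSum.mul_left _ (HasSum.mul_left _ (hasSum_geometric_of_lt_one (by positivity) ?_))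
  rw [Real.exp_lt_one_iff]; linarith

lemma trr_nonneg {a : ℝ} (ha : 0 < a) (ha2 : a < 1 / 2) (u : ℝ) (k : ℕ) : 0 ≤ trr a u k := by
  unfold trr
  have hk : (0 : ℝ) ≤ k := by positivity
  have : 0 < (2 * (k : ℝ) + 3 - 2 * a) := by linarith
  positivity

lemma trr_summable {a u : ℝ} (ha : 0 < a) (ha2 : a < 1 / 2) (hu : 0 < u) : Summable (trr a u) := by
  refine Summable.of_nonneg_of_le (trr_nonneg ha ha2 u) (fun k => ?_) (geo hu 1).summable
  unfold trr
  rw [exp_pow_eq, one_mul]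
  have hk : (0 : ℝ) ≤ k := by positivity
  apply div_le_of_le_mul₀ (by nlinarith) (by positivity)
  have h : 0 < Real.exp (-3 * u) * Real.exp (-2 * u) ^ k := by positivity
  rw [mul_comm]
  apply mul_le_mul_of_nonneg_left _ h.le
  nlinarith

lemma triv_bound {a : ℝ} (ha : 0 < a) (ha2 : a < 1 / 2) (u : ℝ) {t : ℝ} (ht : 0 < t) (k : ℕ) :
    ‖triv a u t k‖ ≤ 1 / t ^ 2 * (Real.exp (-3 * u) * Real.exp (-2 * u) ^ k) := by
  unfold triv
  have n1 : t ≤ ‖pk t k‖ := by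
    have := im_le_norm (pk t k); rwa [pk_im] at this
  have n2 : t ≤ ‖pk t k - 2 * a‖ := by
    have := im_le_norm (pk t k - 2 * a); rw [sub_im, pk_im] at this; simpa using this
  have e : ‖exp (-(pk t k) * u)‖ = Real.exp (-3 * u) * Real.exp (-2 * u) ^ k := by
    rw [norm_exp, ← exp_pow_eq, re_mul_ofReal, neg_re, pk_re]
  rw [norm_div, norm_mul, norm_mul, norm_mul, e, norm_real, Real.norm_of_nonneg ha.le]
  have h2 : ‖(2 : ℂ)‖ = 2 := by simp
  rw [h2]
  calc _ ≤ 1 * (Real.exp (-3 * u) * Real.exp (-2 * u) ^ k) / (t * t) := by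
        gcongr; linarith
    _ = _ := by ring

lemma poleE_zero {a u : ℝ} (hu : 0 ≤ u) :
    poleE a u 0 = ((u - (1 - Real.exp (-(2 * a) * u)) / (2 * a) : ℝ) : ℂ) := by
  unfold poleE trip
  rw [if_pos hu, if_pos (by simp)]
  push_cast
  have e1 : exp u * exp (-u) = 1 := by rw [← exp_add]; simp
  have e2 : exp u * exp (-(1 + 2 * a) * u) = exp (-(2 * a) * u) := by
    rw [← exp_add]; congr 1; ring
  rw [← e2, ← e1]
  linear_combination (u : ℂ) * e1 - (u : ℂ) * 0

lemma poleE_bound {a u t : ℝ} (ha : 0 < a) (ha2 : a < 1 / 2) (ht : 0 < t) (hu : 0 ≤ u) :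
    |(poleE a u t).re| ≤ (1 + Real.exp (-(2 * a) * u)) / t ^ 2 := by
  have htC : (t : ℂ) ≠ 0 := by exact_mod_cast ht.ne'
  have h0 : (t * I : ℂ) ≠ 0 := mul_ne_zero htC I_ne_zero
  have h1 : (t * I - 2 * a : ℂ) ≠ 0 := by
    intro h; have := congrArg re h; simp at this; linarith
  have e : poleE a u t = 1 / (t * I) + (((-Real.exp (-(2 * a) * u) : ℝ) : ℂ) * (1 / (t * I - 2 * a)) +
      2 * a * exp (-(t * I) * u) / (t * I * (t * I - 2 * a))) := by
    unfold poleE trip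
    rw [if_pos hu, if_neg h0]
    have e1 : exp u * exp (-u) = 1 := by rw [← exp_add]; simp
    have e2 : exp u * exp (-(1 + 2 * a) * u) = exp (-(2 * a) * u) := by
      rw [← exp_add]; congr 1; ring
    have e3 : exp u * exp (-(1 + t * I) * u) = exp (-(t * I) * u) := by
      rw [← exp_add]; congr 1; ring
    rw [mul_sub, mul_div_assoc', mul_div_assoc', mul_sub, mul_sub, e1, e2, e3]
    push_cast
    field_simp
    ring
  rw [e, add_re, add_re, re_ofReal_mul]
  have r1 : (1 / (t * I : ℂ)).re = 0 := by simp
  have r2 : |(1 / (t * I - 2 * a : ℂ)).re| ≤ 1 / t ^ 2 := by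
    have : (1 / (t * I - 2 * a : ℂ)).re = -(2 * a) / (4 * a ^ 2 + t ^ 2) := by
      rw [one_div, inv_re, normSq_apply]; simp; ring
    rw [this, abs_div, abs_neg, abs_of_pos (by positivity), abs_of_pos (by positivity),
      div_le_div_iff₀ (by positivity) (by positivity)]
    nlinarith [sq_nonneg a, sq_nonneg t]
  have r3 : |(2 * a * exp (-(t * I) * u) / (t * I * (t * I - 2 * a))).re| ≤ 1 / t ^ 2 := by
    refine (abs_re_le_norm _).trans ?_
    have n2 : t ≤ ‖(t * I - 2 * a : ℂ)‖ := by
      have := im_le_norm (t * I - 2 * a : ℂ); simpa using this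
    rw [norm_div, norm_mul, norm_mul, norm_mul, norm_mul, norm_exp, norm_real, norm_real,
      Real.norm_of_nonneg ha.le, Real.norm_of_nonneg ht.le]
    have h2 : ‖(2 : ℂ)‖ = 2 := by simp
    have h3 : (-(t * I) * u : ℂ).re = 0 := by simp
    rw [h2, h3, Real.exp_zero, norm_I, mul_one, mul_one]
    calc _ ≤ 1 / (t * t) := by gcongr; linarith
      _ = _ := by ring
  rw [r1, zero_add]
  refine (abs_add_le _ _).trans ?_
  rw [abs_mul, abs_neg, abs_of_pos (Real.exp_pos _)]
  calc _ ≤ Real.exp (-(2 * a) * u) * (1 / t ^ 2) + 1 / t ^ 2 := by gcongr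
    _ = _ := by ring

noncomputable def Ua (a u : ℝ) : ℝ :=
  (Psi 1).re - Real.exp (-(2 * a) * u) * (Psi (1 - 2 * a)).re + (u - (1 - Real.exp (-(2 * a) * u)) / (2 * a))
    + 2 * Real.exp (-a * u) * (G (1 / 2)).re - (1 + Real.exp (-(2 * a) * u)) * (G (1 / 2)).re
    - 2 * a * Real.exp (-3 * u) / (3 * (3 - 2 * a))

lemma S_le (RH : RiemannHypothesis) {a u : ℝ} (ha : 0 < a) (ha2 : a < 1 / 2) (hu : 0 < u) :
    Summable (Sr a u) ∧ ∑' k, Sr a u k ≤ Ua a u := by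
  have h := TT_eval RH ha ha2 0 hu.le
  have hm := main_ineq RH (z0 := 1 / 2 + (0 : ℝ) * I) (by simp) ha ha2
    (fun u hu => TT_nonpos RH ha ha2 0 hu) hu.le
  have e0 : (1 / 2 + (0 : ℝ) * I : ℂ) = 1 / 2 := by simp
  have e1 : (1 + (0 : ℝ) * I : ℂ) = 1 := by simp
  rw [e0] at h hm
  rw [e1, poleE_zero hu.le] at h
  have hr := hasSum_re h
  have ee : (exp (-(2 * a) * u) : ℂ) = ((Real.exp (-(2 * a) * u) : ℝ) : ℂ) := by push_cast; rfl
  simp only [SS_zero, triv_zero, add_re, ofReal_re, sub_re] at hr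
  rw [ee, re_ofReal_mul] at hr
  have hm2 := (re_le_norm _).trans hm
  rw [add_re, sub_re, ee, re_ofReal_mul, conj_re] at hm2
  have htr := trr_summable ha ha2 hu
  have hS := hr.sub htr.hasSum
  simp only [add_sub_cancel_right] at hS
  change HasSum (Sr a u) _ at hS
  refine ⟨hS.summable, ?_⟩
  rw [hS.tsum_eq]
  have h0 : trr a u 0 ≤ ∑' k, trr a u k := htr.le_tsum 0 (fun k _ => trr_nonneg ha ha2 u k)
  have h00 : trr a u 0 = 2 * a * Real.exp (-3 * u) / (3 * (3 - 2 * a)) := by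
    unfold trr; simp
  unfold Ua
  rw [← h00]
  linarith

lemma perA (RH : RiemannHypothesis) {a u t ε : ℝ} (ha : 0 < a) (ha2 : a < 1 / 2) (hu : 0 < u)
    (ht : 0 < t) (hε : ε = 1 ∨ ε = -1) :
    ε * (1 - ε * Real.exp (-a * u)) ^ 2 * (deriv riemannZeta (1 + t * I) / riemannZeta (1 + t * I)).re ≤
      Ua a u + (Real.log t - Real.log (2 * Real.pi)) * (Real.exp (-a * u) - ε * Real.exp (-(2 * a) * u))
      + (4 * Real.exp (-a * u) + 5 * Real.exp (-(2 * a) * u) + 1 +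
        Real.exp (-3 * u) / (1 - Real.exp (-2 * u))) / t ^ 2 := by
  obtain ⟨hSs, hSl⟩ := S_le RH ha ha2 hu
  have h := TT_eval RH ha ha2 t hu.le
  have hm := main_ineq RH (z0 := 1 / 2 + t * I) (by simp) ha ha2
    (fun u hu => TT_nonpos RH ha ha2 t hu) hu.le
  have hr := hasSum_re h
  have ee : (exp (-(2 * a) * u) : ℂ) = ((Real.exp (-(2 * a) * u) : ℝ) : ℂ) := by push_cast; rfl
  have hb := geo hu (1 / t ^ 2)
  have hY : |(Psi (1 + t * I) - exp (-(2 * a) * u) * Psi (1 + t * I - 2 * a) + poleE a u t -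
        2 * a * (exp u * TT (1 / 2 + t * I) a u)).re| ≤ (∑' k, Sr a u k) +
        1 / t ^ 2 * (Real.exp (-3 * u) / (1 - Real.exp (-2 * u))) := by
    rw [← hr.tsum_eq, ← Real.norm_eq_abs]
    refine tsum_of_norm_bounded (hSs.hasSum.add hb) (fun k => ?_)
    rw [Real.norm_eq_abs]
    refine (abs_re_le_norm _).trans ((norm_add_le _ _).trans ?_)
    rw [norm_SS ha]
    gcongr
    exact triv_bound ha ha2 u ht k
  have hm2 := (abs_re_le_norm _).trans hm
  rw [add_re, sub_re, ee, re_ofReal_mul, conj_re] at hm2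
  rw [sub_re, add_re, sub_re, ee, re_ofReal_mul] at hY
  have hp := poleE_bound ha ha2 ht hu.le
  have P1 := Psi_re_bound ht (σ := 1) (by norm_num) le_rfl
  have Pa := Psi_re_bound ht (σ := 1 - 2 * a) (by linarith) (by linarith)
  have ea : (((1 - 2 * a : ℝ) : ℂ) + t * I) = 1 + t * I - 2 * a := by push_cast; ring
  rw [ea] at Pa
  rw [ofReal_one] at P1
  have hG : (G (1 / 2 + t * I)).re = (deriv riemannZeta (1 + t * I) / riemannZeta (1 + t * I)).re +
      (Psi (1 + t * I)).re := by
    have htC : (t : ℂ) ≠ 0 := by exact_mod_cast ht.ne'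
    have := G_eq RH (s := 1 + t * I) (by simp; norm_num) (by simp [htC])
    rw [show (1 + t * I - 1 / 2 : ℂ) = 1 / 2 + t * I by ring] at this
    rw [this, add_re, add_re]
    simp
  have hq : Real.exp (-(2 * a) * u) = Real.exp (-a * u) ^ 2 := by
    rw [← Real.exp_nat_mul]; congr 1; push_cast; ring
  rw [hG] at hm2
  have hξ : 0 < Real.exp (-a * u) := Real.exp_pos _
  rw [hq] at hY hp hm2 ⊢
  set ξ := Real.exp (-a * u) with hξd
  set R := (deriv riemannZeta (1 + t * I) / riemannZeta (1 + t * I)).re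
  set p1 := (Psi (1 + t * I)).re
  set p2 := (Psi (1 + t * I - 2 * a)).re
  set Lg := Real.log t - Real.log (2 * Real.pi)
  set T := (2 * a * (exp u * TT (1 / 2 + t * I) a u)).re
  set po := (poleE a u t).re
  set ρ := Real.exp (-3 * u) / (1 - Real.exp (-2 * u))
  have d1 : (4 * ξ + 5 * ξ ^ 2 + 1 + ρ) / t ^ 2 = 2 * ξ * (2 / t ^ 2) + ξ ^ 2 * (4 / t ^ 2) +
    (1 + ξ ^ 2) / t ^ 2 + 1 / t ^ 2 * ρ := by ring
  rw [d1]
  rw [abs_le] at hY hp P1 Pa hm2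
  have m1 : ξ ^ 2 * p2 ≤ ξ ^ 2 * (Lg / 2 + 2 / t ^ 2) := by
    apply mul_le_mul_of_nonneg_left _ (by positivity); linarith [Pa.2]
  have m2 : ξ ^ 2 * (Lg / 2 - 2 / t ^ 2) ≤ ξ ^ 2 * p2 := by
    apply mul_le_mul_of_nonneg_left _ (by positivity); linarith [Pa.1]
  have m3 : ξ ^ 2 * p1 ≤ ξ ^ 2 * (Lg / 2 + 2 / t ^ 2) := by
    apply mul_le_mul_of_nonneg_left _ (by positivity); linarith [P1.2]
  have m4 : ξ ^ 2 * (Lg / 2 - 2 / t ^ 2) ≤ ξ ^ 2 * p1 := by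
    apply mul_le_mul_of_nonneg_left _ (by positivity); linarith [P1.1]
  have m5 : ξ * p1 ≤ ξ * (Lg / 2 + 2 / t ^ 2) := by
    apply mul_le_mul_of_nonneg_left _ (by positivity); linarith [P1.2]
  obtain ⟨hY1, hY2⟩ := hY
  obtain ⟨hp1, hp2⟩ := hp
  obtain ⟨hm1, hm2⟩ := hm2
  clear_value R p1 p2 Lg T po ρ ξ
  rw [show (2 : ℝ) / t ^ 2 = 2 * (1 / t ^ 2) by ring] at *
  rw [show (4 : ℝ) / t ^ 2 = 4 * (1 / t ^ 2) by ring] at *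
  rw [show (1 + ξ ^ 2) / t ^ 2 = (1 + ξ ^ 2) * (1 / t ^ 2) by ring] at *
  generalize 1 / t ^ 2 = i at *
  rcases hε with rfl | rfl
  · nlinarith only [hY1, hp2, hp1, hm2, m1, m2, m3, m4, m5, hSl]
  · nlinarith only [hY2, hp2, hp1, hm1, m1, m2, m3, m4, m5, hSl]

end PMZ



namespace PMZ
open Filter Topology Set MeasureTheory

lemma limit_ineq (RH : RiemannHypothesis) {u t ε : ℝ} (hu : 0 < u)
    (ht : 0 < t) (hε : ε = 1 ∨ ε = -1) :
    ε * (1 - ε * Real.exp (-(1 / 2 : ℝ) * u)) ^ 2 * (deriv riemannZeta (1 + t * I) / riemannZeta (1 + t * I)).re ≤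
      Ua (1 / 2) u + (Real.log t - Real.log (2 * Real.pi)) *
        (Real.exp (-(1 / 2 : ℝ) * u) - ε * Real.exp (-(2 * (1 / 2 : ℝ)) * u))
      + (4 * Real.exp (-(1 / 2 : ℝ) * u) + 5 * Real.exp (-(2 * (1 / 2 : ℝ)) * u) + 1 +
        Real.exp (-3 * u) / (1 - Real.exp (-2 * u))) / t ^ 2 := by
  have cP : ContinuousAt (fun a : ℝ => (Psi (1 - 2 * (a : ℂ))).re) (1 / 2 : ℝ) := by
    have h0 : ContinuousAt Psi (1 - 2 * ((1 / 2 : ℝ) : ℂ)) := Psi_continuousAt (by simp)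
    have h1 : ContinuousAt (fun a : ℝ => (1 - 2 * (a : ℂ))) (1 / 2 : ℝ) := by fun_prop
    exact continuous_re.continuousAt.comp (ContinuousAt.comp (f := fun a : ℝ => (1 - 2 * (a : ℂ))) h0 h1)
  have cU : ContinuousAt (fun a : ℝ => Ua a u) (1 / 2 : ℝ) := by
    unfold Ua
    have d1 : ContinuousAt (fun a : ℝ => (1 - Real.exp (-(2 * a) * u)) / (2 * a)) (1 / 2 : ℝ) :=
      ContinuousAt.div (by fun_prop) (by fun_prop) (by norm_num)
    have d2 : ContinuousAt (fun a : ℝ => 2 * a * Real.exp (-3 * u) / (3 * (3 - 2 * a))) (1 / 2 : ℝ) :=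
      ContinuousAt.div (by fun_prop) (by fun_prop) (by norm_num)
    refine ContinuousAt.sub (ContinuousAt.sub (ContinuousAt.add (ContinuousAt.add (ContinuousAt.sub
      continuousAt_const (ContinuousAt.mul (by fun_prop) cP)) (continuousAt_const.sub d1)) ?_) ?_) d2
    · fun_prop
    · fun_prop
  have cL : ContinuousAt (fun a : ℝ => ε * (1 - ε * Real.exp (-a * u)) ^ 2 *
      (deriv riemannZeta (1 + t * I) / riemannZeta (1 + t * I)).re) (1 / 2 : ℝ) := by fun_prop
  have cR : ContinuousAt (fun a : ℝ => Ua a u + (Real.log t - Real.log (2 * Real.pi)) *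
        (Real.exp (-a * u) - ε * Real.exp (-(2 * a) * u))
      + (4 * Real.exp (-a * u) + 5 * Real.exp (-(2 * a) * u) + 1 +
        Real.exp (-3 * u) / (1 - Real.exp (-2 * u))) / t ^ 2) (1 / 2 : ℝ) := by
    refine ContinuousAt.add (cU.add ?_) ?_
    · fun_prop
    · exact ContinuousAt.div_const (by fun_prop) _
  refine le_of_tendsto_of_tendsto (cL.tendsto.mono_left (nhdsWithin_le_nhds (s := Iio (1 / 2))))
    (cR.tendsto.mono_left (nhdsWithin_le_nhds (s := Iio (1 / 2)))) ?_
  have h1 : ∀ᶠ a : ℝ in 𝓝[<] (1 / 2 : ℝ), 0 < a :=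
    nhdsWithin_le_nhds (eventually_gt_nhds (by norm_num))
  filter_upwards [h1, self_mem_nhdsWithin] with a ha ha2
  exact perA RH ha ha2 hu ht hε

lemma B_neg (RH : RiemannHypothesis) : (G (1 / 2)).re = |Bconst| := by
  have h := G_re_nonneg RH (z := 1 / 2) (by simp)
  have e : (G (1 / 2)).re = -Bconst := by rw [G_half, neg_re, ofReal_re]; rfl
  rw [e] at h ⊢
  rw [abs_of_nonpos (by linarith)]

lemma Ua_half (RH : RiemannHypothesis) (u : ℝ) : Ua (1 / 2) u = u - (1 + Real.eulerMascheroniConstant) +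
    Real.log (2 * Real.pi) * Real.exp (-u) + 2 * |Bconst| * Real.exp (-u / 2) - Real.exp (-3 * u) / 6 := by
  have hB : (G (1 / 2)).re = -Bconst := by rw [G_half, neg_re, ofReal_re]; rfl
  have h1 : (Psi 1).re = -Real.eulerMascheroniConstant / 2 - Real.log Real.pi / 2 + 1 - Real.log 2 := by
    have : Psi 1 = ((-Real.eulerMascheroniConstant / 2 - Real.log Real.pi / 2 + 1 - Real.log 2 : ℝ) : ℂ) := by
      rw [Psi_one]; push_cast; rfl
    rw [this, ofReal_re]
  have h0 : (Psi (1 - 2 * ((1 / 2 : ℝ) : ℂ))).re = -Real.eulerMascheroniConstant / 2 - Real.log Real.pi / 2 := by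
    have : Psi (1 - 2 * ((1 / 2 : ℝ) : ℂ)) = ((-Real.eulerMascheroniConstant / 2 - Real.log Real.pi / 2 : ℝ) : ℂ) := by
      rw [show (1 - 2 * ((1 / 2 : ℝ) : ℂ)) = 0 by push_cast; ring, Psi_zero]; push_cast; rfl
    rw [this, ofReal_re]
  have l4 : Real.log (4 * Real.pi) = 2 * Real.log 2 + Real.log Real.pi := by
    rw [Real.log_mul (by norm_num) Real.pi_ne_zero, show (4 : ℝ) = 2 ^ 2 by norm_num, Real.log_pow]
    push_cast; rfl
  have l2 : Real.log (2 * Real.pi) = Real.log 2 + Real.log Real.pi :=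
    Real.log_mul (by norm_num) Real.pi_ne_zero
  unfold Ua
  rw [h0, h1]
  have e1 : -(2 * (1 / 2 : ℝ)) * u = -u := by ring
  have e2 : -(1 / 2 : ℝ) * u = -u / 2 := by ring
  rw [e1, e2, ← B_neg RH, hB, Bconst, l4, l2]
  ring

lemma E_bound {X ε : ℝ} (hX4 : 4 ≤ X) (hε1 : ε ≤ 1) :
    X ^ 2 / (X - ε) ^ 2 * (4 * (1 / X) + 5 * (1 / X ^ 2) + 1 + 1 / X ^ 6 / (1 - 1 / X ^ 4)) ≤ 6.5 := by
  have hX0 : 0 < X := by linarith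
  have hXe : 0 < X - ε := by linarith
  have i1 : 1 / X ≤ 1 / 4 := one_div_le_one_div_of_le (by norm_num) hX4
  have p2 : (16 : ℝ) ≤ X ^ 2 := by nlinarith
  have p4 : (16 : ℝ) ≤ X ^ 4 := by nlinarith
  have p6 : (16 : ℝ) ≤ X ^ 6 := by nlinarith
  have i2 : 1 / X ^ 2 ≤ 1 / 16 := one_div_le_one_div_of_le (by norm_num) p2
  have i4 : 1 / X ^ 4 ≤ 1 / 16 := one_div_le_one_div_of_le (by norm_num) p4
  have i6 : 1 / X ^ 6 ≤ 1 / 16 := one_div_le_one_div_of_le (by norm_num) p6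
  have i64 : 1 / X ^ 6 / (1 - 1 / X ^ 4) ≤ 1 / 15 := by
    rw [div_le_iff₀ (by linarith)]; linarith
  have j64 : 0 ≤ 1 / X ^ 6 / (1 - 1 / X ^ 4) := div_nonneg (by positivity) (by linarith)
  have j1 : 0 < 1 / X := by positivity
  have j2 : 0 < 1 / X ^ 2 := by positivity
  have hr : X ^ 2 / (X - ε) ^ 2 ≤ 16 / 9 := by
    rw [div_le_div_iff₀ (by positivity) (by norm_num)]
    have h3 : 3 * X ≤ 4 * (X - ε) := by linarith
    have := pow_le_pow_left₀ (by positivity) h3 2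
    linarith [mul_pow 3 X 2, mul_pow 4 (X - ε) 2]
  refine (mul_le_mul hr (b := 16 / 9) (d := 12 / 5) ?_ ?_ (by norm_num)).trans (by norm_num)
  · linarith
  · linarith

lemma final_algebra {X Y ε R Lg M L B t : ℝ} (hX4 : 4 ≤ X) (hY0 : 0 < Y) (hXY : X = Y ^ 2)
    (hε1 : ε ≤ 1)
    (h : ε * (1 - ε * (1 / X)) ^ 2 * R ≤ M + L * (1 / X ^ 2) + 2 * B * (1 / X) - 1 / X ^ 6 / 6
      + Lg * (1 / X - ε * (1 / X ^ 2))
      + (4 * (1 / X) + 5 * (1 / X ^ 2) + 1 + 1 / X ^ 6 / (1 - 1 / X ^ 4)) / t ^ 2) (ht : 0 < t) :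
    ε * R ≤ Lg / (X - ε) + X ^ 2 / (X - ε) ^ 2 * (M + L / X ^ 2 + 2 * B / X)
      + (6.5 / t ^ 2 - 1 / (6 * (Y - ε * (1 / Y)) ^ 2 * X ^ 5)) := by
  have hEb := E_bound hX4 hε1
  have hX0 : 0 < X := by linarith
  have hXe : 0 < X - ε := by linarith
  have hc : 6 * (Y - ε * (1 / Y)) ^ 2 * X ^ 5 = 6 * (X - ε) ^ 2 * X ^ 4 := by
    rw [hXY]; field_simp
  rw [hc]
  have hmul := mul_le_mul_of_nonneg_left h (show 0 ≤ X ^ 2 / (X - ε) ^ 2 by positivity)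
  have e1 : X ^ 2 / (X - ε) ^ 2 * (ε * (1 - ε * (1 / X)) ^ 2 * R) = ε * R := by
    field_simp
  rw [e1] at hmul
  generalize 4 * (1 / X) + 5 * (1 / X ^ 2) + 1 + 1 / X ^ 6 / (1 - 1 / X ^ 4) = E at *
  have hEt : X ^ 2 / (X - ε) ^ 2 * E / t ^ 2 ≤ 6.5 / t ^ 2 :=
    div_le_div_of_nonneg_right hEb (by positivity)
  refine hmul.trans ?_
  have e2 : X ^ 2 / (X - ε) ^ 2 * (Lg * (1 / X - ε * (1 / X ^ 2))) = Lg / (X - ε) := by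
    field_simp
  have e3 : X ^ 2 / (X - ε) ^ 2 * (1 / X ^ 6 / 6) = 1 / (6 * (X - ε) ^ 2 * X ^ 4) := by
    field_simp
  rw [← e2, ← e3]
  generalize X ^ 2 / (X - ε) ^ 2 = K at *
  have : K * (E / t ^ 2) ≤ 6.5 / t ^ 2 := by rw [← mul_div_assoc]; exact hEt
  simp only [div_eq_mul_one_div L, div_eq_mul_one_div (2 * B)]
  linarith

end PMZ

/-- Assuming the Riemann hypothesis, for every real `t > 0`, every
`Δ ≥ 1/2` and each fixed choice of sign `ε = ±1` (so that
`c_Δ^± = (e^{πΔ/2} ∓ e^{−πΔ/2})²`), one has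
`±Re(ζ'/ζ(1+it)) ≤ (log t − log 2π)/(e^{πΔ} ∓ 1)
 + (e^{2πΔ}/(e^{πΔ} ∓ 1)²)(2πΔ − (1+γ) + (log 2π)/e^{2πΔ} + 2|B|/e^{πΔ})
 + (6.5/t² − 1/(6 c_Δ^± e^{5πΔ}))`. -/
theorem pm_re_zeta_logDeriv_upper (RH : RiemannHypothesis) (t Δ ε : ℝ)
    (hε : ε = 1 ∨ ε = -1) (ht : 0 < t) (hΔ : 1 / 2 ≤ Δ) :
    ε * (deriv riemannZeta (1 + t * I) / riemannZeta (1 + t * I)).re ≤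
      (Real.log t - Real.log (2 * Real.pi)) / (Real.exp (Real.pi * Δ) - ε)
        + (Real.exp (2 * Real.pi * Δ) / (Real.exp (Real.pi * Δ) - ε) ^ 2) *
            (2 * Real.pi * Δ - (1 + Real.eulerMascheroniConstant)
              + Real.log (2 * Real.pi) / Real.exp (2 * Real.pi * Δ)
              + 2 * |Bconst| / Real.exp (Real.pi * Δ))
        + (6.5 / t ^ 2
            - 1 / (6 * (Real.exp (Real.pi * Δ / 2) - ε * Real.exp (-(Real.pi * Δ / 2))) ^ 2
                * Real.exp (5 * Real.pi * Δ))) := by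
  have hpi := Real.pi_gt_three
  have hu : 0 < 2 * Real.pi * Δ := by positivity
  have h := PMZ.limit_ineq RH hu ht hε
  rw [PMZ.Ua_half RH] at h
  set X := Real.exp (Real.pi * Δ) with hX
  set Y := Real.exp (Real.pi * Δ / 2) with hY
  have hX0 : 0 < X := Real.exp_pos _
  have hY0 : 0 < Y := Real.exp_pos _
  have hXY : X = Y ^ 2 := by rw [hX, hY, ← Real.exp_nat_mul]; congr 1; push_cast; ring
  have hX4 : 4 ≤ X := by
    have h1 : (1 : ℝ) + 1 / 2 ≤ Real.pi * Δ := by nlinarith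
    have h2 : Real.exp (1 + 1 / 2) ≤ X := Real.exp_le_exp.2 h1
    rw [Real.exp_add] at h2
    have h3 := Real.exp_one_gt_d9
    have h4 := Real.add_one_le_exp (1 / 2 : ℝ)
    nlinarith
  have x2 : Real.exp (2 * Real.pi * Δ) = X ^ 2 := by
    rw [hX, ← Real.exp_nat_mul]; congr 1; push_cast; ring
  have x5 : Real.exp (5 * Real.pi * Δ) = X ^ 5 := by
    rw [hX, ← Real.exp_nat_mul]; congr 1; push_cast; ring
  have y1 : Real.exp (-(Real.pi * Δ / 2)) = 1 / Y := by rw [Real.exp_neg, one_div]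
  have m1 : Real.exp (-(1 / 2 : ℝ) * (2 * Real.pi * Δ)) = 1 / X := by
    rw [one_div X, hX, ← Real.exp_neg]; congr 1; ring
  have m1' : Real.exp (-(2 * Real.pi * Δ) / 2) = 1 / X := by
    rw [one_div X, hX, ← Real.exp_neg]; congr 1; ring
  have m2 : Real.exp (-(2 * (1 / 2 : ℝ)) * (2 * Real.pi * Δ)) = 1 / X ^ 2 := by
    rw [one_div (X ^ 2), ← x2, ← Real.exp_neg]; congr 1; ring
  have m2' : Real.exp (-(2 * Real.pi * Δ)) = 1 / X ^ 2 := by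
    rw [one_div, ← x2, ← Real.exp_neg]
  have m6 : Real.exp (-3 * (2 * Real.pi * Δ)) = 1 / X ^ 6 := by
    rw [one_div, hX, ← Real.exp_nat_mul, ← Real.exp_neg]; congr 1; push_cast; ring
  have m4 : Real.exp (-2 * (2 * Real.pi * Δ)) = 1 / X ^ 4 := by
    rw [one_div, hX, ← Real.exp_nat_mul, ← Real.exp_neg]; congr 1; push_cast; ring
  rw [m1, m1', m2, m2', m6, m4] at h
  rw [x2, x5, y1]
  have hε2 : ε ^ 2 = 1 := by rcases hε with rfl | rfl <;> norm_num
  have hεle : ε ≤ 1 := by rcases hε with rfl | rfl <;> norm_num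
  have hXe : 0 < X - ε := by linarith
  exact PMZ.final_algebra hX4 hY0 hXY hεle h ht
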